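/- arXiv:1611.00269 — 2 statements merged into one kernel-verified Lean document; each statement's English description precedes it below -/
import Mathlib

section
/- (Saito's criterion) Let 𝒜 be a central hyperplane arrangement in an n-dimensional real vector space V with defining linear forms α_H, and let θ₁,…,θₙ ∈ D(𝒜) be homogeneous derivations. Then θ₁,…,θₙ form a basis of the R-module D(𝒜) if and only if θ₁,…,θₙ are R-linearly independent and ∑_{i=1}^n deg θ_i = |𝒜|. -/
open MvPolynomial

noncomputable section

/-- A polynomial vector field `θ = ∑ᵢ θᵢ ∂/∂xᵢ` applied to a polynomial `p`. -/
def applyDer (n : ℕ) (θ : Fin n → MvPolynomial (Fin n) ℝ) (p : MvPolynomial (Fin n) ℝ) :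
    MvPolynomial (Fin n) ℝ :=
  ∑ i : Fin n, θ i * pderiv i p

section LinearForms

variable {σ K : Type*} [Field K]

/-- A nonzero linear form is a prime element of the polynomial ring. -/
lemma MvPolynomial.IsHomogeneous.prime_of_degree_one {p : MvPolynomial σ K}
    (hp : p.IsHomogeneous 1) (h0 : p ≠ 0) : Prime p := by
  refine Irreducible.prime ⟨fun h => ?_, fun a b hab => ?_⟩
  · have := (isUnit_iff_totalDegree_of_isReduced.mp h).2
    rw [hp.totalDegree h0] at this
    exact one_ne_zero this
  · have ha : a ≠ 0 := by rintro rfl; simp_all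
    have hb : b ≠ 0 := by rintro rfl; simp_all
    have hdeg := totalDegree_mul_of_isDomain ha hb
    rw [← hab, hp.totalDegree h0] at hdeg
    have isUnit_of_degree_zero : ∀ q : MvPolynomial σ K, q ≠ 0 → q.totalDegree = 0 → IsUnit q := by
      intro q hq hq0
      rw [totalDegree_eq_zero_iff_eq_C] at hq0
      rw [hq0] at hq ⊢
      exact (IsUnit.mk0 _ fun h => hq (by rw [h, C_0])).map C
    rcases Nat.eq_zero_or_pos a.totalDegree with h | h
    · exact Or.inl (isUnit_of_degree_zero a ha h)
    · exact Or.inr (isUnit_of_degree_zero b hb (by omega))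

lemma MvPolynomial.exists_eq_smul_of_associated {p q : MvPolynomial σ K}
    (h : Associated p q) : ∃ c : K, p = c • q := by
  obtain ⟨u, hu⟩ := h.symm
  obtain ⟨c, -, hc⟩ := isUnit_iff_eq_C_of_isReduced.mp u.isUnit
  exact ⟨c, by rw [← hu, hc, smul_eq_C_mul, mul_comm]⟩

/-- The gradient of a nonzero linear form is a nonzero constant vector. -/
lemma MvPolynomial.IsHomogeneous.exists_gradient [Fintype σ] {p : MvPolynomial σ K}
    (hp : p.IsHomogeneous 1) (h0 : p ≠ 0) :
    ∃ v : σ → K, (∀ i, pderiv i p = C (v i)) ∧ ∃ k, v k ≠ 0 := by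
  have hv : ∀ i, pderiv i p = C (coeff 0 (pderiv i p)) := fun i =>
    totalDegree_eq_zero_iff_eq_C.mp ((totalDegree_zero_iff_isHomogeneous σ).mpr hp.pderiv)
  refine ⟨fun i => coeff 0 (pderiv i p), hv, ?_⟩
  by_contra! h
  apply h0
  have := hp.sum_X_mul_pderiv
  rw [one_smul] at this
  rw [← this]
  exact Finset.sum_eq_zero fun i _ => by rw [hv i, h i, C_0, mul_zero]

/-- The determinant of a matrix with homogeneous rows is homogeneous. -/
lemma MvPolynomial.isHomogeneous_det {ι : Type*} [Fintype ι] [DecidableEq ι]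
    (M : Matrix ι ι (MvPolynomial σ K)) (d : ι → ℕ) (h : ∀ i k, (M i k).IsHomogeneous (d i)) :
    M.det.IsHomogeneous (∑ i, d i) := by
  rw [← Matrix.det_transpose, Matrix.det_apply]
  refine IsHomogeneous.sum _ _ _ fun s _ => ?_
  have := IsHomogeneous.prod Finset.univ (fun i => M i (s i)) d fun i _ => h i _
  rcases Int.units_eq_one_or (Equiv.Perm.sign s) with hs | hs
  · simpa [hs] using this
  · simpa [hs] using this.neg

end LinearForms

section Saito

variable {n m : ℕ} {α : Fin m → MvPolynomial (Fin n) ℝ}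

/-- The polynomial vector field `η` is logarithmic along the hyperplanes `α H = 0`. -/
def IsLogDer (α : Fin m → MvPolynomial (Fin n) ℝ) (η : Fin n → MvPolynomial (Fin n) ℝ) : Prop :=
  ∀ H, α H ∣ applyDer n η (α H)

/-- The determinant of `n` logarithmic derivations is divisible by each linear form. -/
lemma dvd_det_of_isLogDer (hα1 : ∀ H, (α H).IsHomogeneous 1) (hα0 : ∀ H, α H ≠ 0)
    {M : Matrix (Fin n) (Fin n) (MvPolynomial (Fin n) ℝ)} (hM : ∀ i, IsLogDer α (M i))
    (H : Fin m) : α H ∣ M.det := by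
  obtain ⟨v, hv, k, hk⟩ := (hα1 H).exists_gradient (hα0 H)
  choose w hw using fun i => hM i H
  have hMv : M.mulVec (fun i => C (v i)) = α H • w := by
    ext1 i
    simpa [Matrix.mulVec, dotProduct, applyDer, hv] using hw i
  have hdet : M.det • (fun i => (C (v i) : MvPolynomial (Fin n) ℝ))
      = α H • M.adjugate.mulVec w := by
    rw [← Matrix.mulVec_smul, ← hMv, Matrix.mulVec_mulVec, Matrix.adjugate_mul,
      Matrix.smul_mulVec, Matrix.one_mulVec]
  have hunit : IsUnit (C (v k) : MvPolynomial (Fin n) ℝ) := (IsUnit.mk0 _ hk).map C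
  exact hunit.dvd_mul_right.mp ⟨_, congrFun hdet k⟩

lemma not_associated_of_distinct
    (hdist : ∀ H H', H ≠ H' → ∀ c : ℝ, α H ≠ c • α H') {H H' : Fin m} (h : H ≠ H') :
    ¬ Associated (α H) (α H') := fun ha => by
  obtain ⟨c, hc⟩ := exists_eq_smul_of_associated ha
  exact hdist H H' h c hc

/-- The determinant of `n` logarithmic derivations is divisible by the defining polynomial. -/
lemma prod_dvd_det_of_isLogDer (hα1 : ∀ H, (α H).IsHomogeneous 1) (hα0 : ∀ H, α H ≠ 0)
    (hdist : ∀ H H', H ≠ H' → ∀ c : ℝ, α H ≠ c • α H')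
    {M : Matrix (Fin n) (Fin n) (MvPolynomial (Fin n) ℝ)} (hM : ∀ i, IsLogDer α (M i)) :
    ∏ H, α H ∣ M.det := by
  refine Finset.prod_dvd_of_isRelPrime (fun H _ H' _ hne => ?_)
    fun H _ => dvd_det_of_isLogDer hα1 hα0 hM H
  have hp := fun H => ((hα1 H).prime_of_degree_one (hα0 H)).irreducible
  refine (hp H).isRelPrime_iff_not_dvd.mpr fun hd => ?_
  exact not_associated_of_distinct hdist hne ((hp H).associated_of_dvd (hp H') hd)

/-- The matrix with rows `v k • eᵢ - v i • eₖ` for `i ≠ k` and `eₖ` for `i = k`. -/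
def tangentMatrix {ι K : Type*} [DecidableEq ι] [Field K] (v : ι → K) (k : ι) : Matrix ι ι K :=
  fun i => if i = k then Pi.single k 1 else v k • Pi.single i 1 - v i • Pi.single k 1

section TangentMatrix

variable {ι K : Type*} [Fintype ι] [DecidableEq ι] [Field K] (v : ι → K) {k : ι}

lemma tangentMatrix_self_dotProduct (x : ι → K) : tangentMatrix v k k ⬝ᵥ x = x k := by
  simp [tangentMatrix]

lemma tangentMatrix_dotProduct {i : ι} (hi : i ≠ k) (x : ι → K) :
    tangentMatrix v k i ⬝ᵥ x = v k * x i - v i * x k := by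
  simp [tangentMatrix, hi, sub_dotProduct, smul_dotProduct]

lemma det_tangentMatrix_ne_zero (hk : v k ≠ 0) : (tangentMatrix v k).det ≠ 0 := by
  intro h
  obtain ⟨x, hx0, hx⟩ := Matrix.exists_mulVec_eq_zero_iff.mpr h
  apply hx0
  have hxk : x k = 0 := (tangentMatrix_self_dotProduct v x).symm.trans (congrFun hx k)
  ext i
  by_cases hi : i = k
  · rw [hi, hxk, Pi.zero_apply]
  · have h := (tangentMatrix_dotProduct v hi x).symm.trans (congrFun hx i)
    simpa [hxk, hk] using h

end TangentMatrix

lemma isLogDer_prod_smul (η : Fin n → MvPolynomial (Fin n) ℝ) :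
    IsLogDer α ((∏ H, α H) • η) := fun H => by
  simp only [applyDer, Pi.smul_apply, smul_eq_mul, mul_assoc, ← Finset.mul_sum]
  exact (Finset.dvd_prod_of_mem α (Finset.mem_univ H)).mul_right _

/-- For each hyperplane there are `n` logarithmic derivations whose determinant is the defining
polynomial times a power of the product of the remaining linear forms, up to a constant. -/
lemma exists_isLogDer_det_eq (hα1 : ∀ H, (α H).IsHomogeneous 1) (hα0 : ∀ H, α H ≠ 0)
    (H : Fin m) :
    ∃ (N : Matrix (Fin n) (Fin n) (MvPolynomial (Fin n) ℝ)) (u : MvPolynomial (Fin n) ℝ) (e : ℕ),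
      (∀ i, IsLogDer α (N i)) ∧ IsUnit u ∧
        N.det = (∏ H', α H') * (∏ H' ∈ Finset.univ.erase H, α H') ^ e * u := by
  obtain ⟨v, hv, k, hk⟩ := (hα1 H).exists_gradient (hα0 H)
  let D : Fin n → MvPolynomial (Fin n) ℝ := fun i =>
    if i = k then ∏ H', α H' else ∏ H' ∈ Finset.univ.erase H, α H'
  have hDk : D k = ∏ H', α H' := if_pos rfl
  have hDne : ∀ i, i ≠ k → D i = ∏ H' ∈ Finset.univ.erase H, α H' := fun i hi => if_neg hi
  have hperp : ∀ i, i ≠ k → tangentMatrix v k i ⬝ᵥ v = 0 := fun i hi => by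
    rw [tangentMatrix_dotProduct v hi, mul_comm, sub_self]
  have hA := det_tangentMatrix_ne_zero v hk
  generalize tangentMatrix v k = A at hA hperp
  generalize D = D at hDk hDne
  refine ⟨Matrix.of fun i j => D i * A.map C i j, C A.det, (Finset.univ.erase k).card,
    fun i => ?_, (IsUnit.mk0 _ hA).map C, ?_⟩
  · by_cases hi : i = k
    · subst hi
      have h := isLogDer_prod_smul (α := α) (A.map C i)
      rw [← hDk] at h
      exact h
    intro H'
    simp only [applyDer, Matrix.of_apply, mul_assoc, ← Finset.mul_sum]
    by_cases hH : H' = H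
    · subst hH
      have : ∑ j, A i j * v j = 0 := hperp i hi
      simp only [hv, Matrix.map_apply, ← C_mul, ← map_sum, this, C_0, mul_zero, dvd_zero]
    · rw [hDne i hi]
      exact (Finset.dvd_prod_of_mem α (Finset.mem_erase.mpr ⟨hH, Finset.mem_univ _⟩)).mul_right _
  · rw [Matrix.det_mul_column, ← RingHom.mapMatrix_apply, ← RingHom.map_det,
      ← Finset.mul_prod_erase _ _ (Finset.mem_univ k), hDk,
      Finset.prod_eq_pow_card fun i hi => hDne i (Finset.ne_of_mem_erase hi)]

/-- If the rows of `M` generate all logarithmic derivations, `M.det` divides every determinant of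
`n` logarithmic derivations. -/
lemma det_dvd_det_of_span {M N : Matrix (Fin n) (Fin n) (MvPolynomial (Fin n) ℝ)}
    (hM : ∀ η, IsLogDer α η → ∃ c : Fin n → MvPolynomial (Fin n) ℝ, η = ∑ i, c i • M i)
    (hN : ∀ i, IsLogDer α (N i)) : M.det ∣ N.det := by
  choose c hc using fun i => hM (N i) (hN i)
  have : N = Matrix.of c * M := by
    ext1 i j
    rw [hc i]
    simp [Matrix.mul_apply, Finset.sum_apply]
  rw [this, Matrix.det_mul]
  exact dvd_mul_left _ _

/-- If the rows of `M` are logarithmic and generate all logarithmic derivations, then `M.det` is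
associated to the defining polynomial. -/
lemma associated_prod_det_of_span (hα1 : ∀ H, (α H).IsHomogeneous 1) (hα0 : ∀ H, α H ≠ 0)
    (hdist : ∀ H H', H ≠ H' → ∀ c : ℝ, α H ≠ c • α H')
    {M : Matrix (Fin n) (Fin n) (MvPolynomial (Fin n) ℝ)} (hlog : ∀ i, IsLogDer α (M i))
    (hM : ∀ η, IsLogDer α η → ∃ c : Fin n → MvPolynomial (Fin n) ℝ, η = ∑ i, c i • M i)
    (hdet : M.det ≠ 0) : Associated (∏ H, α H) M.det := by
  have hprime := fun H => (hα1 H).prime_of_degree_one (hα0 H)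
  obtain ⟨g, hg⟩ := prod_dvd_det_of_isLogDer hα1 hα0 hdist hlog
  have hQ : ∏ H, α H ≠ 0 := Finset.prod_ne_zero_iff.mpr fun H _ => hα0 H
  suffices IsUnit g from ⟨this.unit, by rw [IsUnit.unit_spec, hg]⟩
  by_contra hgu
  obtain ⟨p, hp, hpg⟩ := WfDvdMonoid.exists_irreducible_factor hgu
    (by rintro rfl; exact hdet (by rw [hg, mul_zero]))
  have hpp := hp.prime
  have hpQ : p ∣ ∏ H, α H := by
    have h := det_dvd_det_of_span (N := (∏ H, α H) • 1) hM fun i => isLogDer_prod_smul _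
    rw [Matrix.det_smul, Matrix.det_one, mul_one] at h
    exact hpp.dvd_of_dvd_pow ((hpg.trans (Dvd.intro_left _ hg.symm)).trans h)
  obtain ⟨H, -, hH⟩ := (hpp.dvd_finsetProd_iff _).mp hpQ
  obtain ⟨N, u, e, hN, hu, hNdet⟩ := exists_isLogDer_det_eq hα1 hα0 H
  have h := det_dvd_det_of_span hM hN
  rw [hg, hNdet, mul_assoc, mul_dvd_mul_iff_left hQ, hu.dvd_mul_right] at h
  obtain ⟨H', hmem, hH'⟩ :=
    (hpp.dvd_finsetProd_iff _).mp (hpp.dvd_of_dvd_pow (hpg.trans h))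
  exact not_associated_of_distinct hdist (Finset.ne_of_mem_erase hmem)
    ((hpp.associated_of_dvd (hprime H') hH').symm.trans (hpp.associated_of_dvd (hprime H) hH))

/-- If `M.det` is associated to the defining polynomial, then the rows of `M` generate all
logarithmic derivations. -/
lemma exists_eq_sum_of_associated (hα1 : ∀ H, (α H).IsHomogeneous 1) (hα0 : ∀ H, α H ≠ 0)
    (hdist : ∀ H H', H ≠ H' → ∀ c : ℝ, α H ≠ c • α H')
    {M : Matrix (Fin n) (Fin n) (MvPolynomial (Fin n) ℝ)} (hlog : ∀ i, IsLogDer α (M i))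
    (hdet : M.det ≠ 0) (hassoc : Associated (∏ H, α H) M.det)
    {η : Fin n → MvPolynomial (Fin n) ℝ} (hη : IsLogDer α η) :
    ∃ c : Fin n → MvPolynomial (Fin n) ℝ, η = ∑ i, c i • M i := by
  have hdvd : ∀ i, M.det ∣ M.transpose.cramer η i := fun i => by
    rw [Matrix.cramer_transpose_apply]
    refine hassoc.symm.dvd.trans (prod_dvd_det_of_isLogDer hα1 hα0 hdist fun j => ?_)
    by_cases hj : j = i
    · rw [hj, Matrix.updateRow_self]; exact hη
    · rw [Matrix.updateRow_ne hj]; exact hlog j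
  choose c hc using hdvd
  refine ⟨c, ?_⟩
  have h := Matrix.mulVec_cramer M.transpose η
  ext1 j
  refine mul_left_cancel₀ hdet ?_
  have hj := congrFun h j
  rw [Matrix.det_transpose, Pi.smul_apply, smul_eq_mul, Matrix.mulVec, dotProduct] at hj
  rw [← hj, Finset.sum_apply, Finset.mul_sum]
  refine Finset.sum_congr rfl fun i _ => ?_
  rw [hc i, Matrix.transpose_apply, Pi.smul_apply, smul_eq_mul]
  ring

end Saito

/-- Saito's criterion: let `𝒜` be a central arrangement of `m` distinct
hyperplanes in `V = ℝⁿ`, given by nonzero linear forms `α H` (pairwise non-proportional).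
Homogeneous derivations `θ₁,…,θₙ ∈ D(𝒜)` of degrees `d₁,…,dₙ` form an `R`-basis of the
logarithmic derivation module `D(𝒜)` if and only if they are `R`-independent and
`∑ dᵢ = |𝒜| = m`. -/
theorem statement4 (n m : ℕ) (α : Fin m → MvPolynomial (Fin n) ℝ)
    (hα1 : ∀ H, (α H).IsHomogeneous 1) (hα0 : ∀ H, α H ≠ 0)
    (hdist : ∀ H H', H ≠ H' → ∀ c : ℝ, α H ≠ c • α H')
    (θ : Fin n → (Fin n → MvPolynomial (Fin n) ℝ)) (d : Fin n → ℕ)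
    (hθD : ∀ i, ∀ H, applyDer n (θ i) (α H) ∈ Ideal.span {α H})
    (hθhom : ∀ i k, (θ i k).IsHomogeneous (d i))
    (hθ0 : ∀ i, θ i ≠ 0) :
    (LinearIndependent (MvPolynomial (Fin n) ℝ) θ ∧
      ∀ η : Fin n → MvPolynomial (Fin n) ℝ,
        (∀ H, applyDer n η (α H) ∈ Ideal.span {α H}) →
        ∃ c : Fin n → MvPolynomial (Fin n) ℝ, η = ∑ i : Fin n, c i • θ i) ↔
    (LinearIndependent (MvPolynomial (Fin n) ℝ) θ ∧ ∑ i : Fin n, d i = m) := by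
  have hlog : ∀ i, IsLogDer α (θ i) := fun i H => Ideal.mem_span_singleton.mp (hθD i H)
  have hQ : ∏ H, α H ≠ 0 := Finset.prod_ne_zero_iff.mpr fun H _ => hα0 H
  have hQhom : (∏ H, α H).IsHomogeneous m := by
    simpa using IsHomogeneous.prod Finset.univ α (fun _ => 1) fun H _ => hα1 H
  have hdethom : (Matrix.of θ).det.IsHomogeneous (∑ i, d i) :=
    isHomogeneous_det (Matrix.of θ) d hθhom
  refine and_congr_right fun hli => ?_
  have hdet : (Matrix.of θ).det ≠ 0 := fun h => by
    obtain ⟨x, hx0, hx⟩ := Matrix.exists_vecMul_eq_zero_iff.mpr h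
    rw [Matrix.vecMul_eq_sum] at hx
    exact hx0 (funext (Fintype.linearIndependent_iff.mp hli x hx))
  constructor
  · intro hspan
    obtain ⟨c, hc⟩ := exists_eq_smul_of_associated
      (associated_prod_det_of_span (M := Matrix.of θ) hα1 hα0 hdist hlog
        (fun η hη => hspan η fun H => Ideal.mem_span_singleton.mpr (hη H)) hdet)
    rw [smul_eq_C_mul] at hc
    exact (hdethom.C_mul c).inj_right (hc ▸ hQhom) (hc ▸ hQ)
  · intro hsum η hη
    obtain ⟨g, hg⟩ := prod_dvd_det_of_isLogDer (M := Matrix.of θ) hα1 hα0 hdist hlog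
    have hg0 : g ≠ 0 := by rintro rfl; exact hdet (by rw [hg, mul_zero])
    have hdeg := totalDegree_mul_of_isDomain hQ hg0
    rw [← hg, hdethom.totalDegree hdet, hQhom.totalDegree hQ, hsum] at hdeg
    have hgC := totalDegree_eq_zero_iff_eq_C.mp (show g.totalDegree = 0 by omega)
    have hgu : IsUnit g := by
      rw [hgC] at hg0 ⊢
      exact (IsUnit.mk0 _ fun h => hg0 (by rw [h, C_0])).map C
    exact exists_eq_sum_of_associated (M := Matrix.of θ) hα1 hα0 hdist hlog hdet
      ⟨hgu.unit, by rw [IsUnit.unit_spec, hg]⟩ fun H => Ideal.mem_span_singleton.mp (hη H)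
end
end

section
/- Let 𝒜 be a free hyperplane arrangement in an n-dimensional real vector space with exponents (d₁,…,dₙ). Then the number of chambers of 𝒜 equals ∏_{i=1}^n (1 + d_i). -/
open MvPolynomial

noncomputable section

/-- Comparison of multiples of a polynomially bounded sequence, up to a shift of the argument. -/
lemma le_of_mul_le_mul_shift (W : ℕ → ℕ) (n : ℕ) (hW : ∀ N, W N ≤ (N + 1) ^ n) (hW0 : 1 ≤ W 0)
    (A D C : ℕ) (h : ∀ N, A * W N ≤ D * W (N + C)) : A ≤ D := by
  by_contra! hlt
  rcases Nat.eq_zero_or_pos D with rfl | hD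
  · have := h 0
    simp at this
    omega
  have key : ∀ k : ℕ, A ^ k ≤ D ^ k * W (k * C) := by
    intro k
    induction k with
    | zero => simpa using hW0
    | succ k ih =>
      calc A ^ (k + 1) = A * A ^ k := by ring
        _ ≤ A * (D ^ k * W (k * C)) := Nat.mul_le_mul_left _ ih
        _ = D ^ k * (A * W (k * C)) := by ring
        _ ≤ D ^ k * (D * W (k * C + C)) := Nat.mul_le_mul_left _ (h _)
        _ = _ := by rw [show (k + 1) * C = k * C + C by ring]; ring
  have hDr : (0 : ℝ) < D := by exact_mod_cast hD
  have hr : (1 : ℝ) < A / D := by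
    rw [one_lt_div hDr]; exact_mod_cast hlt
  have ht := (tendsto_pow_const_div_const_pow_of_one_lt n hr).const_mul ((C + 1 : ℝ) ^ n)
  rw [mul_zero] at ht
  obtain ⟨k, hk1, hk⟩ := ((Filter.eventually_ge_atTop 1).and
    (ht.eventually (gt_mem_nhds one_pos))).exists
  have hpos : (0 : ℝ) < (A / D : ℝ) ^ k := by positivity
  have h1 : (A : ℝ) ^ k ≤ D ^ k * (k * C + 1) ^ n := by
    have := (key k).trans (Nat.mul_le_mul_left _ (hW _))
    exact_mod_cast this
  have h2 : (A / D : ℝ) ^ k ≤ (k * C + 1) ^ n := by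
    rw [div_pow, div_le_iff₀ (by positivity)]
    linarith
  have h3 : ((k : ℝ) * C + 1) ^ n ≤ (C + 1) ^ n * k ^ n := by
    rw [← mul_pow]
    have : (1 : ℝ) ≤ k := by exact_mod_cast hk1
    gcongr
    nlinarith
  rw [← mul_div_assoc, div_lt_one hpos] at hk
  linarith

/-- The exponents of weighted degree at most `N`, for the weights `a`. -/
def weightedExponents {n : ℕ} (a : Fin n → ℕ) (N : ℕ) : Set (Fin n →₀ ℕ) :=
  {e | ∑ i, a i * e i ≤ N}

lemma apply_lt_of_mem_weightedExponents {n : ℕ} {a : Fin n → ℕ} (ha : ∀ i, 1 ≤ a i) {N : ℕ}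
    {e : Fin n →₀ ℕ} (he : e ∈ weightedExponents a N) (i : Fin n) : e i < N + 1 := by
  have h1 : a i * e i ≤ ∑ i, a i * e i :=
    Finset.single_le_sum (f := fun i => a i * e i) (fun _ _ => Nat.zero_le _) (Finset.mem_univ i)
  have h2 : ∑ i, a i * e i ≤ N := he
  have h3 := Nat.mul_le_mul_right (e i) (ha i)
  omega

/-- Exponents of bounded weighted degree, seen in a box. -/
def weightedExponentsToBox {n : ℕ} {a : Fin n → ℕ} (ha : ∀ i, 1 ≤ a i) (N : ℕ)
    (e : weightedExponents a N) (i : Fin n) : Fin (N + 1) :=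
  ⟨e.1 i, apply_lt_of_mem_weightedExponents ha e.2 i⟩

lemma weightedExponentsToBox_injective {n : ℕ} {a : Fin n → ℕ} (ha : ∀ i, 1 ≤ a i) (N : ℕ) :
    Function.Injective (weightedExponentsToBox ha N) := by
  intro e e' h
  ext i
  simpa [weightedExponentsToBox] using congrFun h i

lemma finite_weightedExponents {n : ℕ} {a : Fin n → ℕ} (ha : ∀ i, 1 ≤ a i) (N : ℕ) :
    Finite (weightedExponents a N) :=
  Finite.of_injective _ (weightedExponentsToBox_injective ha N)

lemma card_weightedExponents_le {n : ℕ} {a : Fin n → ℕ} (ha : ∀ i, 1 ≤ a i) (N : ℕ) :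
    Nat.card (weightedExponents a N) ≤ (N + 1) ^ n := by
  simpa using Nat.card_le_card_of_injective _ (weightedExponentsToBox_injective ha N)

lemma one_le_card_weightedExponents {n : ℕ} {a : Fin n → ℕ} (ha : ∀ i, 1 ≤ a i) (N : ℕ) :
    1 ≤ Nat.card (weightedExponents a N) := by
  have := finite_weightedExponents ha N
  have : Nonempty (weightedExponents a N) := ⟨⟨0, by simp [weightedExponents]⟩⟩
  exact Nat.card_pos

lemma card_exponents_le_prod_mul {n : ℕ} {a : Fin n → ℕ} (ha : ∀ i, 1 ≤ a i) (N : ℕ) :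
    Nat.card (weightedExponents (1 : Fin n → ℕ) N) ≤
      (∏ i, a i) * Nat.card (weightedExponents a N) := by
  have := finite_weightedExponents ha N
  let F : weightedExponents (1 : Fin n → ℕ) N → (∀ i, Fin (a i)) × weightedExponents a N :=
    fun e => (fun i => ⟨e.1 i % a i, Nat.mod_lt _ (ha i)⟩,
      ⟨Finsupp.equivFunOnFinite.symm fun i => e.1 i / a i, by
        have h := e.2
        simp only [weightedExponents, Set.mem_ofPred_eq, Pi.one_apply, one_mul] at h
        exact (Finset.sum_le_sum fun i _ => Nat.mul_div_le (e.1 i) (a i)).trans h⟩)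
  have hF : Function.Injective F := by
    intro e e' h
    ext i
    have h1 : e.1 i % a i = e'.1 i % a i := by
      simpa [F] using congrFun (congrArg Prod.fst h) i
    have h2 : e.1 i / a i = e'.1 i / a i := by
      simpa [F] using DFunLike.congr_fun (congrArg (fun x => x.2.1) h) i
    rw [← Nat.div_add_mod (e.1 i) (a i), h1, h2, Nat.div_add_mod]
  simpa [Nat.card_prod, Nat.card_pi] using Nat.card_le_card_of_injective F hF

lemma prod_mul_card_le_card_exponents {n : ℕ} {a : Fin n → ℕ} (N : ℕ) :
    (∏ i, a i) * Nat.card (weightedExponents a N) ≤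
      Nat.card (weightedExponents (1 : Fin n → ℕ) (N + ∑ i, a i)) := by
  have := finite_weightedExponents (a := (1 : Fin n → ℕ)) (fun _ => le_rfl) (N + ∑ i, a i)
  let F : (∀ i, Fin (a i)) × weightedExponents a N →
      weightedExponents (1 : Fin n → ℕ) (N + ∑ i, a i) :=
    fun p => ⟨Finsupp.equivFunOnFinite.symm fun i => a i * p.2.1 i + p.1 i, by
        have h := p.2.2
        simp only [weightedExponents, Set.mem_ofPred_eq] at h
        simp only [weightedExponents, Set.mem_ofPred_eq, Pi.one_apply, one_mul,
          Finsupp.equivFunOnFinite_symm_apply_apply, Finset.sum_add_distrib]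
        exact add_le_add h (Finset.sum_le_sum fun i _ => (p.1 i).2.le)⟩
  have hF : Function.Injective F := by
    rintro ⟨r, e⟩ ⟨r', e'⟩ h
    have h0 : ∀ i, a i * e.1 i + r i = a i * e'.1 i + r' i := fun i => by
      simpa [F] using DFunLike.congr_fun (congrArg Subtype.val h) i
    have hr : r = r' := by
      funext i
      have := congrArg (· % a i) (h0 i)
      simpa [Nat.mul_add_mod, Nat.mod_eq_of_lt (r i).2, Nat.mod_eq_of_lt (r' i).2,
        Fin.ext_iff] using this
    subst hr
    have he : e = e' := by
      ext i
      have := h0 i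
      have hi : 0 < a i := (Nat.zero_le _).trans_lt (r i).2
      exact Nat.eq_of_mul_eq_mul_left hi (by omega)
    rw [he]
  simpa [Nat.card_prod, Nat.card_pi] using Nat.card_le_card_of_injective F hF

/-- Restriction of a polynomial to the parametrized line `t ↦ p + t v`. -/
def restrictLine {n : ℕ} (p v : Fin n → ℝ) : MvPolynomial (Fin n) ℝ →ₐ[ℝ] Polynomial ℝ :=
  aeval fun i => Polynomial.C (p i) + Polynomial.X * Polynomial.C (v i)

lemma eval_restrictLine {n : ℕ} (p v : Fin n → ℝ) (t : ℝ) (g : MvPolynomial (Fin n) ℝ) :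
    (restrictLine p v g).eval t = eval (fun i => p i + t * v i) g := by
  induction g using MvPolynomial.induction_on with
  | C r => simp [restrictLine, Polynomial.algebraMap_eq]
  | add f g hf hg => simp [hf, hg]
  | mul_X f i hf =>
    rw [map_mul, Polynomial.eval_mul, hf, map_mul, eval_X]
    simp only [restrictLine, aeval_X, Polynomial.eval_add, Polynomial.eval_mul, Polynomial.eval_C,
      Polynomial.eval_X]

lemma eval_zero_derivative_restrictLine {n : ℕ} (p v : Fin n → ℝ) (g : MvPolynomial (Fin n) ℝ) :
    (Polynomial.derivative (restrictLine p v g)).eval 0 = ∑ i, v i * eval p (pderiv i g) := by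
  induction g using MvPolynomial.induction_on with
  | C r => simp [restrictLine, Polynomial.algebraMap_eq]
  | add f g hf hg => simp [hf, hg, mul_add, Finset.sum_add_distrib]
  | mul_X f i hf =>
    have h0 : (restrictLine p v f).eval 0 = eval p f := by simp [eval_restrictLine]
    have hX : restrictLine p v (X i) = Polynomial.C (p i) + Polynomial.X * Polynomial.C (v i) := by
      simp [restrictLine]
    simp only [map_mul, Polynomial.derivative_mul, Polynomial.eval_add, Polynomial.eval_mul, hf,
      h0, hX, Derivation.leibniz, smul_eq_mul, pderiv_X, map_add, eval_X]
    simp [Pi.single_apply, mul_add, Finset.sum_add_distrib, Finset.sum_mul, apply_ite]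
    rw [add_comm]
    congr 1
    · ring
    · exact Finset.sum_congr rfl fun _ _ => by ring

lemma aeval_mul_of_isHomogeneous {σ S : Type*} [CommRing S] [Algebra ℝ S]
    {P : MvPolynomial σ ℝ} {s : ℕ} (hP : P.IsHomogeneous s) (t : S) (w : σ → S) :
    aeval (fun j => t * w j) P = t ^ s * aeval w P := by
  rw [aeval_def, aeval_def, eval₂_eq, eval₂_eq, Finset.mul_sum]
  refine Finset.sum_congr rfl fun e he => ?_
  have : e.degree = s := by
    by_contra h
    exact (mem_support_iff.1 he) (hP.coeff_eq_zero h)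
  rw [← this, Finsupp.degree_apply]
  simp only [mul_pow, Finset.prod_mul_distrib, Finset.prod_pow_eq_pow_sum]
  ring

/-- If `f` has simple zeros at the points `p l` and `b` is dual to these points, then the
polynomials `b k` are linearly independent over the algebra generated by `f`. -/
theorem eq_zero_of_sum_mul_aeval_eq_zero {n : ℕ} {ι : Type*} [Fintype ι] [DecidableEq ι]
    (f : Fin n → MvPolynomial (Fin n) ℝ) (p : ι → Fin n → ℝ) (b : ι → MvPolynomial (Fin n) ℝ)
    (hp : ∀ l j, eval (p l) (f j) = 0)
    (hJ : ∀ l, ∀ v : Fin n → ℝ, (∀ j, ∑ i, v i * eval (p l) (pderiv i (f j)) = 0) → v = 0)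
    (hb : ∀ k l, eval (p l) (b k) = if k = l then 1 else 0)
    (P : ι → MvPolynomial (Fin n) ℝ) (hP : ∑ k, b k * aeval f (P k) = 0) : P = 0 := by
  suffices H : ∀ s k, homogeneousComponent s (P k) = 0 by
    funext k
    rw [← sum_homogeneousComponent (P k)]
    exact Finset.sum_eq_zero fun s _ => H s k
  intro s
  induction s using Nat.strong_induction_on with
  | _ s ih =>
  intro l
  have hsurj : Function.Surjective
      (Matrix.mulVecLin (Matrix.of fun j i => eval (p l) (pderiv i (f j)))) := by
    rw [← LinearMap.injective_iff_surjective, ← LinearMap.ker_eq_bot, LinearMap.ker_eq_bot']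
    intro v hv
    refine hJ l v fun j => ?_
    have := congrFun hv j
    simpa [Matrix.mulVec, dotProduct, mul_comm] using this
  refine MvPolynomial.funext fun u => ?_
  rw [map_zero]
  obtain ⟨v, hv⟩ := hsurj u
  have hdvd : ∀ j, ∃ w, restrictLine (p l) v (f j) = Polynomial.X * w := fun j => by
    have : Polynomial.X ∣ restrictLine (p l) v (f j) := by
      rw [Polynomial.X_dvd_iff, Polynomial.coeff_zero_eq_eval_zero, eval_restrictLine]
      simpa using hp l j
    exact this
  choose w hw using hdvd
  have hw0 : ∀ j, (w j).eval 0 = u j := fun j => by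
    have h1 := eval_zero_derivative_restrictLine (p l) v (f j)
    rw [hw j] at h1
    simp only [Polynomial.derivative_mul, Polynomial.derivative_X, one_mul, Polynomial.eval_add,
      Polynomial.eval_mul, Polynomial.eval_X, zero_mul, add_zero] at h1
    rw [h1, ← hv]
    simp [Matrix.mulVec, dotProduct, mul_comm]
  have hexp : ∀ k, ∃ Q : Polynomial ℝ, restrictLine (p l) v (aeval f (P k)) =
      Polynomial.X ^ s * (aeval w (homogeneousComponent s (P k)) + Polynomial.X * Q) := by
    intro k
    have h1 : restrictLine (p l) v (aeval f (P k)) =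
        aeval (fun j => Polynomial.X * w j) (P k) := by
      rw [← funext hw, ← AlgHom.comp_apply]
      congr 1
      ext j
      simp
    have h2 : ∀ P : MvPolynomial (Fin n) ℝ, (∀ t < s, homogeneousComponent t P = 0) →
        Polynomial.X ^ (s + 1) ∣ aeval (fun j => Polynomial.X * w j) P -
          Polynomial.X ^ s * aeval w (homogeneousComponent s P) := by
      intro P hPs
      have hc : Polynomial.X ^ s * aeval w (homogeneousComponent s P) =
          ∑ t ∈ Finset.range (P.totalDegree + s + 1), if t = s then
            Polynomial.X ^ t * aeval w (homogeneousComponent t P) else 0 := by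
        rw [Finset.sum_ite_eq', if_pos (by simp)]
      have hsum : P = ∑ t ∈ Finset.range (P.totalDegree + s + 1), homogeneousComponent t P := by
        conv_lhs => rw [← sum_homogeneousComponent P]
        refine Finset.sum_subset (Finset.range_mono (by omega)) fun t _ ht => ?_
        exact homogeneousComponent_eq_zero _ _ (by simpa using ht)
      rw [hc]
      conv_rhs => enter [1]; rw [hsum, map_sum]
      rw [← Finset.sum_sub_distrib]
      refine Finset.dvd_sum fun t _ => ?_
      rw [aeval_mul_of_isHomogeneous (homogeneousComponent_isHomogeneous t P)]
      rcases lt_trichotomy t s with h | h | h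
      · simp [hPs t h]
      · simp [h]
      · rw [if_neg h.ne', sub_zero]
        exact Dvd.dvd.mul_right (pow_dvd_pow _ h) _
    obtain ⟨Q, hQ⟩ := h2 (P k) fun t ht => ih t ht k
    refine ⟨Q, ?_⟩
    rw [h1, sub_eq_iff_eq_add.1 hQ]
    ring
  choose Q hQ using hexp
  have h3 := congrArg (restrictLine (p l) v) hP
  simp only [map_sum, map_mul, map_zero, hQ] at h3
  have h4 : Polynomial.X ^ s * (∑ k, restrictLine (p l) v (b k) *
      (aeval w (homogeneousComponent s (P k)) + Polynomial.X * Q k)) = 0 := by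
    rw [← h3, Finset.mul_sum]
    exact Finset.sum_congr rfl fun _ _ => by ring
  have h5 := (mul_eq_zero.1 h4).resolve_left (pow_ne_zero _ Polynomial.X_ne_zero)
  have h6 := congrArg (Polynomial.eval 0) h5
  have h7 : ∀ P : MvPolynomial (Fin n) ℝ, (aeval w P).eval 0 = eval u P := fun P => by
    induction P using MvPolynomial.induction_on with
    | C r => simp [Polynomial.algebraMap_eq]
    | add f g hf hg => simp [hf, hg]
    | mul_X f i hf => simp [hf, hw0]
  simpa [Polynomial.eval_finsetSum, eval_restrictLine, hb, h7] using h6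

lemma exists_dual_polynomials {n : ℕ} {ι : Type*} [Fintype ι] [DecidableEq ι]
    (p : ι → Fin n → ℝ) (hp : Function.Injective p) :
    ∃ b : ι → MvPolynomial (Fin n) ℝ, ∀ k l, eval (p l) (b k) = if k = l then 1 else 0 := by
  have H : ∀ k l, ∃ s : MvPolynomial (Fin n) ℝ, k ≠ l → eval (p k) s = 1 ∧ eval (p l) s = 0 := by
    intro k l
    by_cases hkl : k = l
    · exact ⟨0, fun h => (h hkl).elim⟩
    obtain ⟨i, hi⟩ := Function.ne_iff.1 (hp.ne hkl)
    refine ⟨C (p k i - p l i)⁻¹ * (X i - C (p l i)), fun _ => ⟨?_, ?_⟩⟩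
    · simp [inv_mul_cancel₀ (sub_ne_zero.2 hi)]
    · simp
  choose s hs using H
  refine ⟨fun k => ∏ l ∈ Finset.univ.erase k, s k l, fun k l => ?_⟩
  rw [map_prod]
  split_ifs with h
  · subst h
    exact Finset.prod_eq_one fun l hl => (hs k l (Finset.ne_of_mem_erase hl).symm).1
  · exact Finset.prod_eq_zero (Finset.mem_erase.2 ⟨fun h' => h h'.symm, Finset.mem_univ l⟩)
      (hs k l h).2

lemma finrank_restrictSupport {σ : Type*} (s : Set (σ →₀ ℕ)) :
    Module.finrank ℝ (restrictSupport ℝ s) = Nat.card s :=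
  Module.finrank_eq_nat_card_basis (basisRestrictSupport ℝ s)

lemma finite_restrictSupport {σ : Type*} (s : Set (σ →₀ ℕ)) [Finite s] :
    Module.Finite ℝ (restrictSupport ℝ s) :=
  Module.Finite.of_basis (basisRestrictSupport ℝ s)

lemma mem_restrictSupport_weightedExponents_one {n : ℕ} {N : ℕ} {P : MvPolynomial (Fin n) ℝ} :
    P ∈ restrictSupport ℝ (weightedExponents (1 : Fin n → ℕ) N) ↔ P.totalDegree ≤ N := by
  rw [mem_restrictSupport_iff, totalDegree, Finset.sup_le_iff]
  simp only [Set.subset_def, weightedExponents, Set.mem_ofPred_eq, Finset.mem_coe, Pi.one_apply, one_mul,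
    Finsupp.sum_fintype, implies_true]

lemma totalDegree_aeval_le {n : ℕ} {f : Fin n → MvPolynomial (Fin n) ℝ} {a : Fin n → ℕ}
    (hf : ∀ j, (f j).totalDegree ≤ a j) {M : ℕ} {P : MvPolynomial (Fin n) ℝ}
    (hP : P ∈ restrictSupport ℝ (weightedExponents a M)) : (aeval f P).totalDegree ≤ M := by
  rw [aeval_def, eval₂_eq']
  refine totalDegree_finsetSum_le fun e he => ?_
  have h : ∑ i, a i * e i ≤ M := hP he
  refine (totalDegree_mul _ _).trans ?_
  rw [algebraMap_eq, totalDegree_C, zero_add]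
  refine (totalDegree_finsetProd _ _).trans ((Finset.sum_le_sum fun i _ => ?_).trans h)
  refine (totalDegree_pow _ _).trans ?_
  rw [mul_comm]
  exact Nat.mul_le_mul_right _ (hf i)

/-- The linear map `P ↦ ∑ₖ bₖ Pₖ(f)` on polynomials with restricted support. -/
def expansion {n : ℕ} {ι : Type*} [Fintype ι] (f : Fin n → MvPolynomial (Fin n) ℝ)
    (b : ι → MvPolynomial (Fin n) ℝ) (s : Set (Fin n →₀ ℕ)) :
    (ι → restrictSupport ℝ s) →ₗ[ℝ] MvPolynomial (Fin n) ℝ :=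
  ∑ k, LinearMap.mulLeft ℝ (b k) ∘ₗ (aeval f).toLinearMap ∘ₗ
    Submodule.subtype _ ∘ₗ LinearMap.proj k

lemma expansion_apply {n : ℕ} {ι : Type*} [Fintype ι] (f : Fin n → MvPolynomial (Fin n) ℝ)
    (b : ι → MvPolynomial (Fin n) ℝ) (s : Set (Fin n →₀ ℕ)) (P : ι → restrictSupport ℝ s) :
    expansion f b s P = ∑ k, b k * aeval f (P k : MvPolynomial (Fin n) ℝ) := by
  simp [expansion]

/-- The upper bound in Bézout's theorem, for simple real zeros. -/
theorem card_le_prod_of_simple_zeros {n : ℕ} {ι : Type*} [Fintype ι]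
    (f : Fin n → MvPolynomial (Fin n) ℝ) (a : Fin n → ℕ) (ha : ∀ i, 1 ≤ a i)
    (hf : ∀ j, (f j).totalDegree ≤ a j) (p : ι → Fin n → ℝ) (hinj : Function.Injective p)
    (hp : ∀ l j, eval (p l) (f j) = 0)
    (hJ : ∀ l, ∀ v : Fin n → ℝ, (∀ j, ∑ i, v i * eval (p l) (pderiv i (f j)) = 0) → v = 0) :
    Fintype.card ι ≤ ∏ i, a i := by
  classical
  obtain ⟨b, hb⟩ := exists_dual_polynomials p hinj
  set c := ∑ k, (b k).totalDegree with hc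
  refine le_of_mul_le_mul_shift (fun N => Nat.card (weightedExponents a N)) n
    (card_weightedExponents_le ha) (one_le_card_weightedExponents ha 0) _ _ c fun N => ?_
  refine le_trans ?_ (card_exponents_le_prod_mul ha (N + c))
  have := finite_weightedExponents ha N
  have := finite_weightedExponents (a := (1 : Fin n → ℕ)) (fun _ => le_rfl) (N + c)
  have := finite_restrictSupport (weightedExponents a N)
  have := finite_restrictSupport (weightedExponents (1 : Fin n → ℕ) (N + c))
  have hmem : ∀ P, expansion f b (weightedExponents a N) P ∈
      restrictSupport ℝ (weightedExponents (1 : Fin n → ℕ) (N + c)) := by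
    intro P
    rw [mem_restrictSupport_weightedExponents_one, expansion_apply]
    refine totalDegree_finsetSum_le fun k _ => (totalDegree_mul _ _).trans ?_
    rw [add_comm]
    exact add_le_add (totalDegree_aeval_le hf (P k).2)
      (Finset.single_le_sum (f := fun k => (b k).totalDegree) (fun _ _ => Nat.zero_le _)
        (Finset.mem_univ k))
  have hinj' : Function.Injective ((expansion f b (weightedExponents a N)).codRestrict _ hmem) := by
    rw [← LinearMap.ker_eq_bot, LinearMap.ker_codRestrict, LinearMap.ker_eq_bot']
    intro P hP
    rw [expansion_apply] at hP
    have := eq_zero_of_sum_mul_aeval_eq_zero f p b hp hJ hb (fun k => (P k : _)) hP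
    funext k
    exact Subtype.ext (congrFun this k)
  have := LinearMap.finrank_le_finrank_of_injective hinj'
  simpa [Module.finrank_pi_fintype, finrank_restrictSupport] using this

lemma exists_isHomogeneous_of_mem_span {n N : ℕ} {h : Fin n → MvPolynomial (Fin n) ℝ}
    {a : Fin n → ℕ} (hh : ∀ j, (h j).IsHomogeneous (a j)) (haN : ∀ j, a j ≤ N)
    {P : MvPolynomial (Fin n) ℝ} (hP : P.IsHomogeneous N) (hmem : P ∈ Ideal.span (Set.range h)) :
    ∃ q : Fin n → MvPolynomial (Fin n) ℝ,
      (∀ j, (q j).IsHomogeneous (N - a j)) ∧ P = ∑ j, h j * q j := by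
  obtain ⟨c, hc⟩ := Ideal.mem_span_range_iff_exists_fun.1 hmem
  refine ⟨fun j => homogeneousComponent (N - a j) (c j),
    fun j => homogeneousComponent_isHomogeneous _ _, ?_⟩
  have hmul : ∀ j, homogeneousComponent N (c j * h j) =
      h j * homogeneousComponent (N - a j) (c j) := fun j => by
    let _ := gradedAlgebra (σ := Fin n) (R := ℝ)
    have := DirectSum.coe_decompose_mul_of_left_mem_of_le
      (homogeneousSubmodule (Fin n) ℝ) (b := c j) ((mem_homogeneousSubmodule _ _).2 (hh j)) (haN j)
    rw [mul_comm (c j), ← decomposition.decompose'_apply, ← decomposition.decompose'_apply]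
    exact this
  rw [← homogeneousComponent_eq_self ((mem_homogeneousSubmodule _ _).2 hP), ← hc, map_sum]
  exact Finset.sum_congr rfl fun j _ => hmul j

/-- Elements `∑ Pᵤ(f) xᵘ` with `deg u ≤ M` and `Pᵤ` of weighted degree at most `N`. -/
def boundedExpansions {n : ℕ} (f : Fin n → MvPolynomial (Fin n) ℝ) (a : Fin n → ℕ) (M N : ℕ) :
    AddSubmonoid (MvPolynomial (Fin n) ℝ) :=
  AddSubmonoid.closure {x | ∃ u ∈ weightedExponents (1 : Fin n → ℕ) M,
    ∃ P ∈ restrictSupport ℝ (weightedExponents a N), x = aeval f P * monomial u 1}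

lemma weightedExponents_mono {n : ℕ} (a : Fin n → ℕ) {N N' : ℕ} (h : N ≤ N') :
    weightedExponents a N ⊆ weightedExponents a N' := fun _ he => le_trans he h

lemma mul_mem_restrictSupport_weightedExponents {n : ℕ} {a : Fin n → ℕ} {N N' : ℕ}
    {P Q : MvPolynomial (Fin n) ℝ} (hP : P ∈ restrictSupport ℝ (weightedExponents a N))
    (hQ : Q ∈ restrictSupport ℝ (weightedExponents a N')) :
    P * Q ∈ restrictSupport ℝ (weightedExponents a (N + N')) := by
  have h := Submodule.mul_mem_mul hP hQ
  rw [← restrictSupport_add] at h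
  refine restrictSupport_mono _ ?_ h
  rintro _ ⟨e, he, e', he', rfl⟩
  simp only [weightedExponents, Set.mem_ofPred_eq, Finsupp.add_apply, mul_add,
    Finset.sum_add_distrib] at he he' ⊢
  exact add_le_add he he'

lemma boundedExpansions_mono {n : ℕ} (f : Fin n → MvPolynomial (Fin n) ℝ) (a : Fin n → ℕ) (M : ℕ)
    {N N' : ℕ} (h : N ≤ N') : boundedExpansions f a M N ≤ boundedExpansions f a M N' := by
  refine AddSubmonoid.closure_mono ?_
  rintro _ ⟨u, hu, P, hP, rfl⟩
  exact ⟨u, hu, P, restrictSupport_mono _ (weightedExponents_mono a h) hP, rfl⟩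

lemma mul_mem_boundedExpansions {n : ℕ} {f : Fin n → MvPolynomial (Fin n) ℝ} {a : Fin n → ℕ}
    {M N N' : ℕ} {Q g : MvPolynomial (Fin n) ℝ}
    (hQ : Q ∈ restrictSupport ℝ (weightedExponents a N'))
    (hg : g ∈ boundedExpansions f a M N) :
    aeval f Q * g ∈ boundedExpansions f a M (N' + N) := by
  induction hg using AddSubmonoid.closure_induction with
  | mem x hx =>
    obtain ⟨u, hu, P, hP, rfl⟩ := hx
    exact AddSubmonoid.subset_closure ⟨u, hu, Q * P,
      mul_mem_restrictSupport_weightedExponents hQ hP, by rw [map_mul, mul_assoc]⟩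
  | zero => rw [mul_zero]; exact zero_mem _
  | add x y _ _ hx hy => rw [mul_add]; exact add_mem hx hy

/-- If the leading forms `h` of `f` generate an ideal that contains powers of all variables, then
the polynomial ring is finite over the algebra generated by `f`, with control of degrees. -/
theorem exists_forall_mem_boundedExpansions {n : ℕ} (f h : Fin n → MvPolynomial (Fin n) ℝ)
    (a : Fin n → ℕ) (ha : ∀ i, 1 ≤ a i) (hh : ∀ j, (h j).IsHomogeneous (a j))
    (hf : ∀ j, (h j - f j).totalDegree < a j)
    (hX : ∀ i, X i ∈ (Ideal.span (Set.range h)).radical) :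
    ∃ M, ∀ N g, g.totalDegree ≤ N → g ∈ boundedExpansions f a M N := by
  choose k hk using hX
  refine ⟨∑ i, k i + ∑ i, a i, fun N => ?_⟩
  set M := ∑ i, k i + ∑ i, a i with hM
  induction N using Nat.strong_induction_on with
  | _ N ih =>
  intro g hg
  rw [g.as_sum]
  refine sum_mem fun c hc => ?_
  generalize coeff c g = r
  have hcN : ∑ i, c i ≤ N := by
    have := (mem_restrictSupport_weightedExponents_one.2 hg) hc
    simpa [weightedExponents] using this
  by_cases hcM : ∑ i, c i ≤ M
  · refine AddSubmonoid.subset_closure ⟨c, by simpa [weightedExponents] using hcM, C r, ?_, ?_⟩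
    · rw [C_apply, monomial_mem_restrictSupport]
      left
      simp [weightedExponents]
    · simp [C_mul_monomial]
  by_cases hcN' : ∑ i, c i < N
  · refine boundedExpansions_mono f a M hcN'.le (ih _ hcN' _ ?_)
    refine (totalDegree_monomial_le _ _).trans ?_
    simp [Finsupp.sum_fintype]
  have hdeg : ∑ i, c i = N := le_antisymm hcN (not_lt.1 hcN')
  obtain ⟨i, hi⟩ : ∃ i, k i ≤ c i := by
    by_contra! hlt
    exact hcM ((Finset.sum_le_sum fun i _ => (hlt i).le).trans (Nat.le_add_right _ _))
  have hmem : monomial c r ∈ Ideal.span (Set.range h) := by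
    have : monomial c r = monomial (c - Finsupp.single i (k i)) r * X i ^ k i := by
      rw [X_pow_eq_monomial, monomial_mul, mul_one, tsub_add_cancel_of_le]
      simpa using hi
    rw [this]
    exact Ideal.mul_mem_left _ _ (hk i)
  have haN : ∀ j, a j ≤ N := fun j => by
    have := Finset.single_le_sum (f := a) (fun _ _ => Nat.zero_le _) (Finset.mem_univ j)
    omega
  obtain ⟨q, hq, hsum⟩ := exists_isHomogeneous_of_mem_span hh haN
    (isHomogeneous_monomial (d := c) (n := N) r (by rw [Finsupp.degree_eq_sum]; exact hdeg)) hmem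
  have hsplit : monomial c r = ∑ j, (f j * q j + (h j - f j) * q j) := by
    rw [hsum]
    exact Finset.sum_congr rfl fun j _ => by ring
  rw [hsplit]
  refine sum_mem fun j _ => add_mem ?_ ?_
  · have hj := ha j
    have hjN := haN j
    have h1 := ih (N - a j) (by omega) (q j) (hq j).totalDegree_le
    have h2 : (X j : MvPolynomial (Fin n) ℝ) ∈ restrictSupport ℝ (weightedExponents a (a j)) := by
      rw [X, monomial_mem_restrictSupport]
      left
      simp [weightedExponents, Finsupp.single_apply]
    have h3 := mul_mem_boundedExpansions h2 h1
    rwa [aeval_X, Nat.add_sub_cancel' hjN] at h3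
  · have hj := ha j
    have hjN := haN j
    refine boundedExpansions_mono f a M (Nat.sub_le N 1) (ih (N - 1) (by omega) _ ?_)
    have h1 := totalDegree_mul (h j - f j) (q j)
    have h2 := (hq j).totalDegree_le
    have h3 := hf j
    omega

/-- Nakayama's lemma for a ring homomorphism `φ` and a family `b` generating modulo `φ(𝔪)`. -/
theorem exists_forall_mul_eq_sum {A B ι : Type*} [CommRing A] [CommRing B] [Fintype ι]
    (φ : A →+* B) (𝔪 : Ideal A) (b : ι → B) (U : Set B) (hU : U.Finite)
    (hgen : ∀ x, x ∈ AddSubmonoid.closure {y | ∃ u ∈ U, ∃ r, y = φ r * u})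
    (hb : ∀ x, ∃ c : ι → A, x - ∑ k, φ (c k) * b k ∈ Ideal.map φ 𝔪) :
    ∃ r, r - 1 ∈ 𝔪 ∧ ∀ x, ∃ c : ι → A, φ r * x = ∑ k, φ (c k) * b k := by
  algebraize [φ]
  have hfin : (⊤ : Submodule A B).FG := by
    refine Submodule.fg_def.2 ⟨U, hU, eq_top_iff.2 fun x _ => ?_⟩
    refine (AddSubmonoid.closure_le (S := (Submodule.span A U).toAddSubmonoid)).2 ?_ (hgen x)
    rintro _ ⟨u, hu, r, rfl⟩
    exact Submodule.smul_mem _ r (Submodule.subset_span hu)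
  have hsmul : (⊤ : Submodule A B) ≤ Submodule.span A (Set.range b) ⊔ 𝔪 • ⊤ := by
    intro x _
    obtain ⟨c, hc⟩ := hb x
    rw [← sub_add_cancel x (∑ k, φ (c k) * b k), add_comm]
    refine Submodule.add_mem_sup ?_ ?_
    · exact Submodule.sum_mem _ fun k _ =>
        Submodule.smul_mem _ (c k) (Submodule.subset_span ⟨k, rfl⟩)
    · rw [Ideal.smul_top_eq_map]
      exact hc
  obtain ⟨r, hr, hle⟩ := Submodule.exists_sub_one_mem_and_smul_le_of_fg_of_le_sup hfin le_rfl hsmul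
  refine ⟨r, hr, fun x => ?_⟩
  have := hle (Submodule.smul_mem_pointwise_smul x r ⊤ trivial)
  obtain ⟨c, hc⟩ := (Submodule.mem_span_range_iff_exists_fun A).1 this
  exact ⟨c, hc.symm⟩

lemma sub_taylor_mem_sq {n : ℕ} (p : Fin n → ℝ) (g : MvPolynomial (Fin n) ℝ) :
    g - C (eval p g) - ∑ i, C (eval p (pderiv i g)) * (X i - C (p i)) ∈
      RingHom.ker (eval p) * RingHom.ker (eval p) := by
  have hX : ∀ i, X i - C (p i) ∈ RingHom.ker (eval p) := fun i => by simp [RingHom.mem_ker]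
  induction g using MvPolynomial.induction_on with
  | C r => simp
  | add f g hf hg =>
    convert add_mem hf hg using 1
    simp only [map_add, add_mul, Finset.sum_add_distrib]
    ring
  | mul_X f i hf =>
    have h1 : (f - C (eval p f)) * (X i - C (p i)) ∈
        RingHom.ker (eval p) * RingHom.ker (eval p) :=
      Ideal.mul_mem_mul (by simp [RingHom.mem_ker]) (hX i)
    have h2 := Ideal.mul_mem_left _ (C (p i)) hf
    convert add_mem h2 h1 using 1
    have h3 : ∀ j, C (eval p (pderiv j (f * X i))) * (X j - C (p j)) =
        C (p i) * (C (eval p (pderiv j f)) * (X j - C (p j))) +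
          (if j = i then C (eval p f) * (X i - C (p i)) else 0) := fun j => by
      by_cases hj : j = i
      · subst hj
        simp [Derivation.leibniz]
        ring
      · simp [Derivation.leibniz, pderiv_X, hj, Ne.symm hj]
        ring
    simp only [h3, Finset.sum_add_distrib, ← Finset.mul_sum, Finset.sum_ite_eq',
      Finset.mem_univ, if_true, map_mul, eval_X]
    ring

/-- Near a simple zero `p` of `f`, the ideal generated by `f` is the maximal ideal of `p`. -/
lemma exists_mul_mem_span_of_simple_zero {n : ℕ} (f : Fin n → MvPolynomial (Fin n) ℝ)
    (p : Fin n → ℝ) (hp : ∀ j, eval p (f j) = 0)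
    (hJ : ∀ v : Fin n → ℝ, (∀ j, ∑ i, v i * eval p (pderiv i (f j)) = 0) → v = 0) :
    ∃ r, eval p r = 1 ∧ ∀ g, eval p g = 0 → r * g ∈ Ideal.span (Set.range f) := by
  set 𝔪 := RingHom.ker (eval p) with h𝔪
  set I := Ideal.span (Set.range f) with hI
  let J : Matrix (Fin n) (Fin n) ℝ := Matrix.of fun j i => eval p (pderiv i (f j))
  have hinj : Function.Injective J.mulVec := by
    have : Function.Injective J.mulVecLin := by
      rw [← LinearMap.ker_eq_bot, LinearMap.ker_eq_bot']
      intro v hv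
      refine hJ v fun j => ?_
      have := congrFun hv j
      simpa [J, Matrix.mulVec, dotProduct, mul_comm] using this
    exact this
  have hunit : IsUnit J := Matrix.mulVec_injective_iff_isUnit.1 hinj
  have hinv : J⁻¹ * J = 1 := Matrix.nonsing_inv_mul _ ((Matrix.isUnit_iff_isUnit_det _).1 hunit)
  have hX : ∀ i, X i - C (p i) ∈ I ⊔ 𝔪 * 𝔪 := by
    intro i
    have h1 : ∑ j, C (J⁻¹ i j) * f j ∈ I :=
      sum_mem fun j _ => Ideal.mul_mem_left _ _ (Ideal.subset_span ⟨j, rfl⟩)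
    have h2 : ∑ j, C (J⁻¹ i j) * (f j - C (eval p (f j)) -
        ∑ k, C (eval p (pderiv k (f j))) * (X k - C (p k))) ∈ 𝔪 * 𝔪 :=
      sum_mem fun j _ => Ideal.mul_mem_left _ _ (sub_taylor_mem_sq p (f j))
    have h3 : ∑ j, C (J⁻¹ i j) * (∑ k, C (eval p (pderiv k (f j))) * (X k - C (p k))) =
        X i - C (p i) := by
      simp only [Finset.mul_sum]
      rw [Finset.sum_comm]
      have : ∀ k, ∑ j, C (J⁻¹ i j) * (C (eval p (pderiv k (f j))) * (X k - C (p k))) =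
          if i = k then X k - C (p k) else 0 := fun k => by
        have h4 : ∑ j, J⁻¹ i j * eval p (pderiv k (f j)) = if i = k then 1 else 0 := by
          have := congrFun (congrFun hinv i) k
          rwa [Matrix.mul_apply, Matrix.one_apply] at this
        simp only [← mul_assoc, ← C_mul, ← Finset.sum_mul, ← map_sum, h4]
        split_ifs <;> simp
      simp [this]
    have h5 : X i - C (p i) = ∑ j, C (J⁻¹ i j) * f j - ∑ j, C (J⁻¹ i j) *
        (f j - C (eval p (f j)) - ∑ k, C (eval p (pderiv k (f j))) * (X k - C (p k))) := by
      rw [← h3]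
      simp only [hp, map_zero, sub_zero, mul_sub, Finset.sum_sub_distrib]
      ring
    rw [h5]
    exact sub_mem (Ideal.mem_sup_left h1) (Ideal.mem_sup_right h2)
  have hle : 𝔪 ≤ I ⊔ 𝔪 • 𝔪 := by
    intro g hg
    have h1 := sub_taylor_mem_sq p g
    rw [RingHom.mem_ker.1 hg, map_zero, sub_zero] at h1
    rw [← sub_add_cancel g (∑ i, C (eval p (pderiv i g)) * (X i - C (p i)))]
    exact add_mem (Ideal.mem_sup_right h1)
      (sum_mem fun i _ => Ideal.mul_mem_left _ _ (hX i))
  obtain ⟨r, hr, hrle⟩ := Submodule.exists_sub_one_mem_and_smul_le_of_fg_of_le_sup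
    (IsNoetherian.noetherian 𝔪) le_rfl hle
  refine ⟨r, ?_, fun g hg => ?_⟩
  · rw [RingHom.mem_ker, map_sub, map_one] at hr
    linarith
  · exact hrle (Submodule.smul_mem_pointwise_smul g r 𝔪 hg)

lemma aeval_ofReal {n : ℕ} (p : Fin n → ℝ) (g : MvPolynomial (Fin n) ℝ) :
    aeval (fun i => (p i : ℂ)) g = (eval p g : ℂ) := by
  have := aeval_algebraMap_apply (A := ℝ) ℂ p g
  simpa [Function.comp_def] using this

/-- If all complex zeros of `f` are real and simple, then the ideal generated by `f` is radical. -/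
lemma mem_span_of_forall_eval_eq_zero {n : ℕ} (f : Fin n → MvPolynomial (Fin n) ℝ)
    (hreal : ∀ z : Fin n → ℂ, (∀ j, aeval z (f j) = 0) → ∃ p : Fin n → ℝ, z = fun i => (p i : ℂ))
    (hJ : ∀ p : Fin n → ℝ, (∀ j, eval p (f j) = 0) →
      ∀ v : Fin n → ℝ, (∀ j, ∑ i, v i * eval p (pderiv i (f j)) = 0) → v = 0)
    (g : MvPolynomial (Fin n) ℝ)
    (hg : ∀ p : Fin n → ℝ, (∀ j, eval p (f j) = 0) → eval p g = 0) :
    g ∈ Ideal.span (Set.range f) := by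
  set I := Ideal.span (Set.range f) with hI
  let K : Ideal (MvPolynomial (Fin n) ℝ) := Submodule.comap (LinearMap.mulRight _ g) I
  have hK : ∀ s, s ∈ K ↔ s * g ∈ I := fun s => Iff.rfl
  by_contra hgI
  have hKtop : K ≠ ⊤ := fun h => hgI (by
    have : (1 : MvPolynomial (Fin n) ℝ) ∈ K := h ▸ trivial
    rwa [hK, one_mul] at this)
  obtain ⟨M, hM, hKM⟩ := Ideal.exists_le_maximal K hKtop
  obtain ⟨z, rfl⟩ := eq_vanishingIdeal_singleton_of_isMaximal ℂ hM
  have hz : ∀ j, aeval z (f j) = 0 := fun j => by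
    rw [← mem_vanishingIdeal_singleton_iff]
    exact hKM ((hK _).2 (Ideal.mul_mem_right _ _ (Ideal.subset_span ⟨j, rfl⟩)))
  obtain ⟨p, rfl⟩ := hreal z hz
  have hp : ∀ j, eval p (f j) = 0 := fun j => by
    have := hz j
    rw [aeval_ofReal] at this
    exact_mod_cast this
  obtain ⟨r, hr, hrg⟩ := exists_mul_mem_span_of_simple_zero f p hp (hJ p hp)
  have := hKM ((hK r).2 (hrg g (hg p hp)))
  rw [mem_vanishingIdeal_singleton_iff, aeval_ofReal, hr] at this
  simp at this

lemma exists_mem_restrictSupport {n : ℕ} (a : Fin n → ℕ) (P : MvPolynomial (Fin n) ℝ) :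
    ∃ N, P ∈ restrictSupport ℝ (weightedExponents a N) :=
  ⟨P.support.sup fun e => ∑ i, a i * e i, fun _ he =>
    Finset.le_sup (f := fun e : Fin n →₀ ℕ => ∑ i, a i * e i) he⟩

/-- The lower bound in Bézout's theorem, when there are no zeros at infinity. -/
theorem prod_le_card_of_radical {n : ℕ} {ι : Type*} [Fintype ι]
    (f h : Fin n → MvPolynomial (Fin n) ℝ) (a : Fin n → ℕ) (ha : ∀ i, 1 ≤ a i)
    (hh : ∀ j, (h j).IsHomogeneous (a j)) (hf : ∀ j, (h j - f j).totalDegree < a j)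
    (hX : ∀ i, X i ∈ (Ideal.span (Set.range h)).radical)
    (p : ι → Fin n → ℝ) (hinj : Function.Injective p) (hp : ∀ l j, eval (p l) (f j) = 0)
    [hne : Nonempty ι]
    (hrad : ∀ g, (∀ k, eval (p k) g = 0) → g ∈ Ideal.span (Set.range f)) :
    ∏ i, a i ≤ Fintype.card ι := by
  classical
  obtain ⟨b, hb⟩ := exists_dual_polynomials p hinj
  obtain ⟨M, hM⟩ := exists_forall_mem_boundedExpansions f h a ha hh hf hX
  have hfinM := finite_weightedExponents (a := (1 : Fin n → ℕ)) (fun _ => le_rfl) M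
  obtain ⟨Q, hQ1, hQ⟩ := exists_forall_mul_eq_sum (aeval f : _ →ₐ[ℝ] _).toRingHom
    (Ideal.span (Set.range (X : Fin n → MvPolynomial (Fin n) ℝ))) b
    ((fun u => monomial u (1 : ℝ)) '' weightedExponents (1 : Fin n → ℕ) M)
    (Set.Finite.image _ hfinM)
    (fun x => by
      refine AddSubmonoid.closure_mono ?_ (hM _ x le_rfl)
      rintro _ ⟨u, hu, P, _, rfl⟩
      exact ⟨_, ⟨u, hu, rfl⟩, P, rfl⟩)
    (fun x => by
      refine ⟨fun k => C (eval (p k) x), ?_⟩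
      have hmap : Ideal.map (aeval f : _ →ₐ[ℝ] _).toRingHom
          (Ideal.span (Set.range (X : Fin n → MvPolynomial (Fin n) ℝ))) =
          Ideal.span (Set.range f) := by
        rw [Ideal.map_span, ← Set.range_comp]
        congr 2
        funext j
        simp
      rw [hmap]
      refine hrad _ fun l => ?_
      simp [hb])
  simp only [AlgHom.toRingHom_eq_coe, RingHom.coe_coe] at hQ
  choose R hR using fun u : weightedExponents (1 : Fin n → ℕ) M => hQ (monomial u.1 1)
  choose N₀ hN₀ using fun u k => exists_mem_restrictSupport a (R u k)
  have := Fintype.ofFinite (weightedExponents (1 : Fin n → ℕ) M)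
  set c := ∑ u, ∑ k, N₀ u k with hc
  have hRc : ∀ u k, R u k ∈ restrictSupport ℝ (weightedExponents a c) := fun u k => by
    refine restrictSupport_mono _ (weightedExponents_mono a ?_) (hN₀ u k)
    exact (Finset.single_le_sum (f := fun k => N₀ u k) (fun _ _ => Nat.zero_le _)
      (Finset.mem_univ k)).trans (Finset.single_le_sum (f := fun u => ∑ k, N₀ u k)
        (fun _ _ => Nat.zero_le _) (Finset.mem_univ u))
  have hrange : ∀ N g, g ∈ restrictSupport ℝ (weightedExponents (1 : Fin n → ℕ) N) →
      aeval f Q * g ∈ LinearMap.range (expansion f b (weightedExponents a (N + c))) := by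
    intro N g hg
    have hg' := hM N g (mem_restrictSupport_weightedExponents_one.1 hg)
    clear hg
    induction hg' using AddSubmonoid.closure_induction with
    | mem x hx =>
      obtain ⟨u, hu, P, hP, rfl⟩ := hx
      refine ⟨fun k => ⟨P * R ⟨u, hu⟩ k,
        mul_mem_restrictSupport_weightedExponents hP (hRc _ k)⟩, ?_⟩
      rw [expansion_apply, mul_left_comm, hR ⟨u, hu⟩, Finset.mul_sum]
      refine Finset.sum_congr rfl fun k _ => ?_
      rw [map_mul]
      ring
    | zero => rw [mul_zero]; exact zero_mem _
    | add x y _ _ hx hy => rw [mul_add]; exact add_mem hx hy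
  have hQ0 : aeval f Q ≠ 0 := by
    intro h0
    obtain ⟨l⟩ := hne
    have h1 : ∀ P : MvPolynomial (Fin n) ℝ, eval (p l) (aeval f P) = eval 0 P := fun P => by
      induction P using MvPolynomial.induction_on with
      | C r => simp
      | add f g hf hg => rw [map_add, map_add, map_add, hf, hg]
      | mul_X f i hf => simp [hp]
    have h2 : Q - 1 ∈ RingHom.ker (eval (0 : Fin n → ℝ)) := by
      refine Ideal.span_le.2 ?_ hQ1
      rintro _ ⟨i, rfl⟩
      simp [RingHom.mem_ker]
    have h3 := h1 Q
    rw [RingHom.mem_ker, map_sub, map_one] at h2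
    rw [h0, map_zero] at h3
    linarith
  refine le_of_mul_le_mul_shift (fun N => Nat.card (weightedExponents a N)) n
    (card_weightedExponents_le ha) (one_le_card_weightedExponents ha 0) _ _
    (∑ i, a i + c) fun N => ?_
  refine (prod_mul_card_le_card_exponents N).trans ?_
  have := finite_weightedExponents ha (N + (∑ i, a i + c))
  have := finite_restrictSupport (weightedExponents a (N + (∑ i, a i + c)))
  let Φ : restrictSupport ℝ (weightedExponents (1 : Fin n → ℕ) (N + ∑ i, a i)) →ₗ[ℝ]
      LinearMap.range (expansion f b (weightedExponents a (N + (∑ i, a i + c)))) :=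
    LinearMap.codRestrict _ (LinearMap.mulLeft ℝ (aeval f Q) ∘ₗ Submodule.subtype _) fun g => by
      have := hrange _ g.1 g.2
      rwa [add_assoc] at this
  have hΦ : Function.Injective Φ := by
    intro g g' hgg
    have : aeval f Q * g.1 = aeval f Q * g'.1 := congrArg Subtype.val hgg
    exact Subtype.ext (mul_left_cancel₀ hQ0 this)
  have h1 := LinearMap.finrank_le_finrank_of_injective hΦ
  have h2 := LinearMap.finrank_range_le (expansion f b (weightedExponents a (N + (∑ i, a i + c))))
  have h3 := h1.trans h2
  simpa [Module.finrank_pi_fintype, finrank_restrictSupport] using h3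

/-- A case of Bézout's theorem: if `f` has no zeros at infinity and all complex zeros are real and
simple, then the number of zeros is the product of the degrees. -/
theorem card_zeros_eq_prod {n : ℕ} (f h : Fin n → MvPolynomial (Fin n) ℝ) (a : Fin n → ℕ)
    (ha : ∀ i, 1 ≤ a i) (hh : ∀ j, (h j).IsHomogeneous (a j))
    (hf : ∀ j, (h j - f j).totalDegree < a j)
    (hinf : ∀ z : Fin n → ℂ, (∀ j, aeval z (h j) = 0) → z = 0)
    (hreal : ∀ z : Fin n → ℂ, (∀ j, aeval z (f j) = 0) → ∃ p : Fin n → ℝ, z = fun i => (p i : ℂ))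
    (hJ : ∀ p : Fin n → ℝ, (∀ j, eval p (f j) = 0) →
      ∀ v : Fin n → ℝ, (∀ j, ∑ i, v i * eval p (pderiv i (f j)) = 0) → v = 0)
    (hne : ∃ p : Fin n → ℝ, ∀ j, eval p (f j) = 0) :
    Nat.card {p : Fin n → ℝ // ∀ j, eval p (f j) = 0} = ∏ i, a i := by
  have hX : ∀ i, X i ∈ (Ideal.span (Set.range h)).radical := fun i => by
    rw [← vanishingIdeal_zeroLocus_eq_radical (K := ℂ), mem_vanishingIdeal_iff]
    intro z hz
    rw [hinf z fun j => hz _ (Ideal.subset_span ⟨j, rfl⟩)]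
    simp
  have hfa : ∀ j, (f j).totalDegree ≤ a j := fun j => by
    rw [show f j = h j - (h j - f j) by ring]
    exact (totalDegree_sub _ _).trans (max_le (hh j).totalDegree_le (hf j).le)
  have hfin : Finite {p : Fin n → ℝ // ∀ j, eval p (f j) = 0} := by
    by_contra hinfinite
    rw [not_finite_iff_infinite] at hinfinite
    obtain ⟨s, hs⟩ := Infinite.exists_subset_card_eq
      {p : Fin n → ℝ // ∀ j, eval p (f j) = 0} (∏ i, a i + 1)
    have := card_le_prod_of_simple_zeros f a ha hfa (fun x : s => x.1.1)
      (Subtype.val_injective.comp Subtype.val_injective) (fun l => l.1.2) (fun l => hJ _ l.1.2)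
    rw [Fintype.card_coe, hs] at this
    omega
  have := Fintype.ofFinite {p : Fin n → ℝ // ∀ j, eval p (f j) = 0}
  have : Nonempty {p : Fin n → ℝ // ∀ j, eval p (f j) = 0} := let ⟨p, hp⟩ := hne; ⟨p, hp⟩
  rw [Nat.card_eq_fintype_card]
  refine le_antisymm ?_ ?_
  · exact card_le_prod_of_simple_zeros f a ha hfa _ Subtype.val_injective (fun l => l.2)
      (fun l => hJ _ l.2)
  · exact prod_le_card_of_radical f h a ha hh hf hX _ Subtype.val_injective (fun l => l.2)
      fun g hg => mem_span_of_forall_eval_eq_zero f hreal hJ g fun p hp => hg ⟨p, hp⟩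

/-- The linear form with coefficient vector `u`. -/
def linForm {n : ℕ} (u : Fin n → ℝ) : MvPolynomial (Fin n) ℝ := ∑ i, C (u i) * X i

lemma eval_linForm {n : ℕ} (u x : Fin n → ℝ) : eval x (linForm u) = ∑ i, u i * x i := by
  simp [linForm]

lemma aeval_linForm {n : ℕ} (u : Fin n → ℝ) (z : Fin n → ℂ) :
    aeval z (linForm u) = ∑ i, (u i : ℂ) * z i := by
  simp [linForm]

lemma pderiv_linForm {n : ℕ} (u : Fin n → ℝ) (i : Fin n) : pderiv i (linForm u) = C (u i) := by
  simp [linForm, pderiv_X, Pi.single_apply, Derivation.leibniz]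

lemma exists_eq_linForm {n : ℕ} {P : MvPolynomial (Fin n) ℝ} (hP : P.IsHomogeneous 1) :
    ∃ u, P = linForm u := by
  have h := (mem_homogeneousSubmodule 1 P).2 hP
  rw [homogeneousSubmodule_one_eq_span_X, Submodule.mem_span_range_iff_exists_fun] at h
  obtain ⟨c, hc⟩ := h
  exact ⟨c, by simp [← hc, linForm, smul_eq_C_mul]⟩

lemma isHomogeneous_linForm {n : ℕ} (u : Fin n → ℝ) : (linForm u).IsHomogeneous 1 :=
  IsHomogeneous.sum _ _ _ fun _ _ => isHomogeneous_C_mul_X _ _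

/-- The vector field `η` is logarithmic along the hyperplanes `A H`, with quotients `r`. -/
def IsLogarithmic {n m : ℕ} (A : Fin m → Fin n → ℝ) (η : Fin n → MvPolynomial (Fin n) ℝ)
    (r : Fin m → MvPolynomial (Fin n) ℝ) : Prop :=
  ∀ H, ∑ i, η i * C (A H i) = r H * linForm (A H)

lemma isLogarithmic_X {n m : ℕ} (A : Fin m → Fin n → ℝ) : IsLogarithmic A X fun _ => 1 :=
  fun H => by simp [linForm, mul_comm]

lemma isLogarithmic_prod_mul_C {n m : ℕ} (A : Fin m → Fin n → ℝ) (S : Finset (Fin m))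
    (v : Fin n → ℝ) (hv : ∀ H ∉ S, ∑ i, A H i * v i = 0) :
    IsLogarithmic A (fun i => (∏ H ∈ S, linForm (A H)) * C (v i))
      fun H => C (∑ i, A H i * v i) * ∏ H' ∈ S.erase H, linForm (A H') := by
  intro H
  have h1 : ∑ i, ((∏ H ∈ S, linForm (A H)) * C (v i)) * C (A H i) =
      (∏ H ∈ S, linForm (A H)) * C (∑ i, A H i * v i) := by
    rw [map_sum, Finset.mul_sum]
    exact Finset.sum_congr rfl fun i _ => by rw [C_mul]; ring
  rw [h1]
  by_cases hH : H ∈ S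
  · rw [← Finset.mul_prod_erase S _ hH]
    ring
  · simp [hv H hH]

/-- The derivative of the master function `∑ log |A H| - |x|² / 2`, up to sign, along the vector
field `η` with quotients `r`. -/
def masterDer {n m : ℕ} (η : Fin n → MvPolynomial (Fin n) ℝ)
    (r : Fin m → MvPolynomial (Fin n) ℝ) : MvPolynomial (Fin n) ℝ :=
  ∑ i, X i * η i - ∑ H, r H

/-- The critical points of `∑ log |A H| - |x|² / 2`. -/
def IsCriticalPoint {n m : ℕ} (A : Fin m → Fin n → ℝ) (p : Fin n → ℝ) : Prop :=
  ∀ v : Fin n → ℝ, ∑ i, v i * p i = ∑ H, (∑ i, A H i * v i) / ∑ i, A H i * p i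

section Basis

variable {n m : ℕ} {A : Fin m → Fin n → ℝ} {θ : Fin n → Fin n → MvPolynomial (Fin n) ℝ}
  {q : Fin n → Fin m → MvPolynomial (Fin n) ℝ}

lemma linForm_ne_zero {u : Fin n → ℝ} (hu : u ≠ 0) : linForm u ≠ 0 := by
  intro h
  refine hu (funext fun i => ?_)
  have := pderiv_linForm u i
  rw [h, map_zero] at this
  simpa using this.symm

lemma exists_masterDer_eq (hA : ∀ H, A H ≠ 0) (hq : ∀ j, IsLogarithmic A (θ j) (q j))
    (hspan : ∀ η r, IsLogarithmic A η r → ∃ c : Fin n → MvPolynomial (Fin n) ℝ,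
      η = ∑ j, c j • θ j)
    {η : Fin n → MvPolynomial (Fin n) ℝ} {r : Fin m → MvPolynomial (Fin n) ℝ}
    (hη : IsLogarithmic A η r) :
    ∃ c : Fin n → MvPolynomial (Fin n) ℝ, ∑ i, X i * η i = ∑ j, c j * ∑ i, X i * θ j i ∧
      masterDer η r = ∑ j, c j * masterDer (θ j) (q j) := by
  obtain ⟨c, hc⟩ := hspan η r hη
  have hηi : ∀ i, η i = ∑ j, c j * θ j i := fun i => by
    rw [hc]; simp [Finset.sum_apply]
  have hr : ∀ H, r H = ∑ j, c j * q j H := fun H => by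
    refine mul_right_cancel₀ (linForm_ne_zero (hA H)) ?_
    rw [← hη H, Finset.sum_mul]
    simp only [mul_assoc, ← hq _ H, hηi, Finset.sum_mul, Finset.mul_sum]
    exact Finset.sum_comm
  have h1 : ∑ i, X i * η i = ∑ j, c j * ∑ i, X i * θ j i := by
    simp only [hηi, Finset.mul_sum]
    rw [Finset.sum_comm]
    exact Finset.sum_congr rfl fun j _ => Finset.sum_congr rfl fun i _ => by ring
  refine ⟨c, h1, ?_⟩
  simp only [masterDer, h1, hr, mul_sub, Finset.sum_sub_distrib]
  congr 1
  simp only [Finset.mul_sum]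
  exact Finset.sum_comm

lemma re_sum_ofReal_mul (u : Fin n → ℝ) (z : Fin n → ℂ) :
    (∑ i, (u i : ℂ) * z i).re = ∑ i, u i * (z i).re := by simp

lemma im_sum_ofReal_mul (u : Fin n → ℝ) (z : Fin n → ℂ) :
    (∑ i, (u i : ℂ) * z i).im = ∑ i, u i * (z i).im := by simp

lemma eq_zero_of_sum_mul_self {v : Fin n → ℝ} (h : ∑ i, v i * v i ≤ 0) : v = 0 := by
  have h0 := le_antisymm h (Finset.sum_nonneg fun i _ => mul_self_nonneg _)
  funext i
  simpa using (Finset.sum_eq_zero_iff_of_nonneg fun i _ => mul_self_nonneg _).1 h0 i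
    (Finset.mem_univ i)

/-- The leading forms of the critical equations have no common nontrivial zero. -/
lemma eq_zero_of_aeval_leadingForm_eq_zero (hA : ∀ H, A H ≠ 0)
    (hq : ∀ j, IsLogarithmic A (θ j) (q j))
    (hspan : ∀ η r, IsLogarithmic A η r → ∃ c : Fin n → MvPolynomial (Fin n) ℝ,
      η = ∑ j, c j • θ j)
    (z : Fin n → ℂ) (hz : ∀ j, aeval z (∑ i, X i * θ j i) = 0) : z = 0 := by
  classical
  set S : Finset (Fin m) := Finset.univ.filter fun H => ∑ i, (A H i : ℂ) * z i ≠ 0 with hS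
  have key : ∀ v : Fin n → ℝ, (∀ H ∉ S, ∑ i, A H i * v i = 0) → ∑ i, (v i : ℂ) * z i = 0 := by
    intro v hv
    obtain ⟨c, hc, -⟩ := exists_masterDer_eq hA hq hspan (isLogarithmic_prod_mul_C A S v hv)
    have h1 := congrArg (aeval z) hc
    rw [map_sum, map_sum] at h1
    simp only [map_mul (aeval z) (c _), hz, mul_zero, Finset.sum_const_zero] at h1
    have h2 : aeval z (∏ H ∈ S, linForm (A H)) * ∑ i, (v i : ℂ) * z i = 0 := by
      rw [← h1, Finset.mul_sum]
      refine Finset.sum_congr rfl fun i _ => ?_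
      simp only [map_mul, aeval_X, aeval_C, Complex.coe_algebraMap]
      ring
    refine (mul_eq_zero.1 h2).resolve_left ?_
    rw [map_prod]
    refine Finset.prod_ne_zero_iff.2 fun H hH => ?_
    rw [aeval_linForm]
    exact (Finset.mem_filter.1 hH).2
  have hz0 : ∀ H ∉ S, ∑ i, (A H i : ℂ) * z i = 0 := fun H hH => by simpa [hS] using hH
  have hre := key (fun i => (z i).re) fun H hH => by
    rw [← re_sum_ofReal_mul, hz0 H hH, Complex.zero_re]
  have him := key (fun i => (z i).im) fun H hH => by
    rw [← im_sum_ofReal_mul, hz0 H hH, Complex.zero_im]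
  have h1 := congrArg Complex.re hre
  have h2 := congrArg Complex.im him
  rw [re_sum_ofReal_mul, Complex.zero_re] at h1
  rw [im_sum_ofReal_mul, Complex.zero_im] at h2
  have h3 := eq_zero_of_sum_mul_self h1.le
  have h4 := eq_zero_of_sum_mul_self h2.le
  funext i
  exact Complex.ext (congrFun h3 i) (congrFun h4 i)

/-- The critical equations away from the hyperplanes containing a solution. -/
lemma sum_mul_eq_sum_div_of_masterDer_eq_zero (hA : ∀ H, A H ≠ 0)
    (hq : ∀ j, IsLogarithmic A (θ j) (q j))
    (hspan : ∀ η r, IsLogarithmic A η r → ∃ c : Fin n → MvPolynomial (Fin n) ℝ,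
      η = ∑ j, c j • θ j)
    (z : Fin n → ℂ) (hz : ∀ j, aeval z (masterDer (θ j) (q j)) = 0)
    (v : Fin n → ℝ) (hv : ∀ H, ∑ i, (A H i : ℂ) * z i = 0 → ∑ i, A H i * v i = 0) :
    ∑ i, (v i : ℂ) * z i = ∑ H, (∑ i, A H i * v i : ℝ) / ∑ i, (A H i : ℂ) * z i := by
  classical
  set S : Finset (Fin m) := Finset.univ.filter fun H => ∑ i, (A H i : ℂ) * z i ≠ 0 with hS
  have hv' : ∀ H ∉ S, ∑ i, A H i * v i = 0 := fun H hH => hv H (by simpa [hS] using hH)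
  obtain ⟨c, -, hc⟩ := exists_masterDer_eq hA hq hspan (isLogarithmic_prod_mul_C A S v hv')
  have h1 := congrArg (aeval z) hc
  simp only [map_sum (aeval z) (fun j => c j * masterDer (θ j) (q j)), map_mul (aeval z) (c _),
    hz, mul_zero, Finset.sum_const_zero] at h1
  rw [masterDer, map_sub, sub_eq_zero, map_sum, map_sum] at h1
  have hne : aeval z (∏ H ∈ S, linForm (A H)) ≠ 0 := by
    rw [map_prod, Finset.prod_ne_zero_iff]
    intro H hH
    rw [aeval_linForm]
    exact (Finset.mem_filter.1 hH).2
  refine mul_left_cancel₀ hne ?_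
  rw [Finset.mul_sum, Finset.mul_sum]
  convert h1 using 1
  · refine Finset.sum_congr rfl fun i _ => ?_
    simp only [map_mul, aeval_X, aeval_C, Complex.coe_algebraMap]
    ring
  · refine Finset.sum_congr rfl fun H _ => ?_
    rw [map_mul, aeval_C, Complex.coe_algebraMap]
    by_cases hH : H ∈ S
    · rw [← Finset.mul_prod_erase S _ hH, map_mul, aeval_linForm]
      have : ∑ i, (A H i : ℂ) * z i ≠ 0 := (Finset.mem_filter.1 hH).2
      field_simp
    · rw [hv' H hH]
      simp

/-- No solution of the critical equations lies on a hyperplane. -/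
lemma ne_zero_of_masterDer_eq_zero (hA : ∀ H, A H ≠ 0)
    (hq : ∀ j, IsLogarithmic A (θ j) (q j))
    (hspan : ∀ η r, IsLogarithmic A η r → ∃ c : Fin n → MvPolynomial (Fin n) ℝ,
      η = ∑ j, c j • θ j)
    (z : Fin n → ℂ) (hz : ∀ j, aeval z (masterDer (θ j) (q j)) = 0) (H : Fin m) :
    ∑ i, (A H i : ℂ) * z i ≠ 0 := by
  classical
  have key := sum_mul_eq_sum_div_of_masterDer_eq_zero hA hq hspan z hz
  have hre := key (fun i => (z i).re) fun H hH => by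
    rw [← re_sum_ofReal_mul, hH, Complex.zero_re]
  have him := key (fun i => (z i).im) fun H hH => by
    rw [← im_sum_ofReal_mul, hH, Complex.zero_im]
  have h1 : ∑ i, z i * z i = ∑ H, if ∑ i, (A H i : ℂ) * z i = 0 then (0 : ℂ) else 1 := by
    have h2 : ∑ i, z i * z i =
        ∑ i, ((z i).re : ℂ) * z i + Complex.I * ∑ i, ((z i).im : ℂ) * z i := by
      rw [Finset.mul_sum, ← Finset.sum_add_distrib]
      refine Finset.sum_congr rfl fun i _ => ?_
      conv_lhs => enter [1]; rw [← Complex.re_add_im (z i)]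
      ring
    rw [h2, hre, him, Finset.mul_sum, ← Finset.sum_add_distrib]
    refine Finset.sum_congr rfl fun H _ => ?_
    rw [← re_sum_ofReal_mul, ← im_sum_ofReal_mul]
    split_ifs with h0
    · simp [h0]
    · rw [← mul_div_assoc, ← add_div, mul_comm Complex.I, Complex.re_add_im, div_self h0]
  have h3 : ∑ i, z i * z i = ∑ H : Fin m, (1 : ℂ) := by
    obtain ⟨c, -, hc⟩ := exists_masterDer_eq hA hq hspan (isLogarithmic_X A)
    have h4 := congrArg (aeval z) hc
    simp only [map_sum (aeval z) (fun j => c j * masterDer (θ j) (q j)), map_mul (aeval z) (c _),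
      hz, mul_zero, Finset.sum_const_zero] at h4
    rw [masterDer, map_sub, sub_eq_zero, map_sum, map_sum] at h4
    simpa using h4
  intro hH
  have h5 : ∑ H, ((if ∑ i, (A H i : ℂ) * z i = 0 then 0 else 1 : ℝ)) = ∑ H : Fin m, (1 : ℝ) := by
    have := h1.symm.trans h3
    exact_mod_cast this
  have h6 := Finset.sum_lt_sum (s := Finset.univ)
    (f := fun H => (if ∑ i, (A H i : ℂ) * z i = 0 then 0 else 1 : ℝ)) (g := fun _ => 1)
    (fun H _ => by split_ifs <;> norm_num) ⟨H, Finset.mem_univ H, by simp [hH]⟩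
  exact h6.ne h5

/-- All complex solutions of the critical equations are real. -/
lemma exists_ofReal_of_masterDer_eq_zero (hA : ∀ H, A H ≠ 0)
    (hq : ∀ j, IsLogarithmic A (θ j) (q j))
    (hspan : ∀ η r, IsLogarithmic A η r → ∃ c : Fin n → MvPolynomial (Fin n) ℝ,
      η = ∑ j, c j • θ j)
    (z : Fin n → ℂ) (hz : ∀ j, aeval z (masterDer (θ j) (q j)) = 0) :
    ∃ p : Fin n → ℝ, z = fun i => (p i : ℂ) := by
  have hne := ne_zero_of_masterDer_eq_zero hA hq hspan z hz
  have key := sum_mul_eq_sum_div_of_masterDer_eq_zero hA hq hspan z hz (fun i => (z i).im)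
    fun H hH => (hne H hH).elim
  have h1 := congrArg Complex.im key
  rw [im_sum_ofReal_mul, Complex.im_sum] at h1
  have h2 : ∑ i, (z i).im * (z i).im ≤ 0 := by
    rw [h1]
    refine Finset.sum_nonpos fun H _ => ?_
    rw [← im_sum_ofReal_mul, div_eq_mul_inv, Complex.im_ofReal_mul, Complex.inv_im]
    rw [neg_div, mul_neg, neg_nonpos, ← mul_div_assoc]
    exact div_nonneg (mul_self_nonneg _) (Complex.normSq_nonneg _)
  have h3 := eq_zero_of_sum_mul_self h2
  exact ⟨fun i => (z i).re, funext fun i => Complex.ext rfl (by simpa using congrFun h3 i)⟩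

/-- The real solutions of the critical equations. -/
lemma forall_eval_masterDer_eq_zero_iff (hA : ∀ H, A H ≠ 0)
    (hq : ∀ j, IsLogarithmic A (θ j) (q j))
    (hspan : ∀ η r, IsLogarithmic A η r → ∃ c : Fin n → MvPolynomial (Fin n) ℝ,
      η = ∑ j, c j • θ j)
    (p : Fin n → ℝ) :
    (∀ j, eval p (masterDer (θ j) (q j)) = 0) ↔
      (∀ H, ∑ i, A H i * p i ≠ 0) ∧ IsCriticalPoint A p := by
  constructor
  · intro hp
    have hz : ∀ j, aeval (fun i => (p i : ℂ)) (masterDer (θ j) (q j)) = 0 := fun j => by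
      rw [aeval_ofReal, hp j, Complex.ofReal_zero]
    have hne := ne_zero_of_masterDer_eq_zero hA hq hspan _ hz
    refine ⟨fun H => by exact_mod_cast hne H, fun v => ?_⟩
    have key := sum_mul_eq_sum_div_of_masterDer_eq_zero hA hq hspan _ hz v
      fun H hH => (hne H hH).elim
    exact_mod_cast key
  · rintro ⟨hne, hp⟩ j
    have h1 := hp fun i => eval p (θ j i)
    rw [masterDer, map_sub, map_sum, map_sum, sub_eq_zero]
    simp only [map_mul, eval_X]
    simp only [mul_comm (p _)]
    rw [h1]
    refine Finset.sum_congr rfl fun H _ => ?_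
    rw [div_eq_iff (hne H), ← eval_linForm (A H) p, ← map_mul, ← hq j H, map_sum]
    simp [mul_comm]

/-- The real solutions of the critical equations are simple. -/
lemma eq_zero_of_masterDer_derivative_eq_zero (hA : ∀ H, A H ≠ 0)
    (hq : ∀ j, IsLogarithmic A (θ j) (q j))
    (hspan : ∀ η r, IsLogarithmic A η r → ∃ c : Fin n → MvPolynomial (Fin n) ℝ,
      η = ∑ j, c j • θ j)
    (p : Fin n → ℝ) (hp : ∀ j, eval p (masterDer (θ j) (q j)) = 0) (v : Fin n → ℝ)
    (hv : ∀ j, ∑ i, v i * eval p (pderiv i (masterDer (θ j) (q j))) = 0) : v = 0 := by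
  classical
  obtain ⟨hne, hcrit⟩ := (forall_eval_masterDer_eq_zero_iff hA hq hspan p).1 hp
  let δ : MvPolynomial (Fin n) ℝ →ₗ[ℝ] ℝ :=
    { toFun := fun g => ∑ i, v i * eval p (pderiv i g)
      map_add' := fun f g => by simp [mul_add, Finset.sum_add_distrib]
      map_smul' := fun r g => by
        simp [smul_eval, Finset.mul_sum, mul_left_comm] }
  have hδ : ∀ g, δ g = ∑ i, v i * eval p (pderiv i g) := fun _ => rfl
  have hδmul : ∀ f g, δ (f * g) = δ f * eval p g + eval p f * δ g := fun f g => by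
    simp only [hδ, Derivation.leibniz, smul_eq_mul, map_add, map_mul, mul_add,
      Finset.sum_add_distrib, Finset.sum_mul, Finset.mul_sum]
    rw [add_comm]
    congr 1 <;> exact Finset.sum_congr rfl fun _ _ => by ring
  have hδC : ∀ r, δ (C r) = 0 := fun r => by simp [hδ]
  have hδlin : ∀ u : Fin n → ℝ, δ (linForm u) = ∑ i, u i * v i := fun u => by
    simp [hδ, pderiv_linForm, mul_comm]
  obtain ⟨c, -, hc⟩ := exists_masterDer_eq hA hq hspan
    (isLogarithmic_prod_mul_C A Finset.univ v fun H hH => (hH (Finset.mem_univ H)).elim)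
  have h1 := congrArg δ hc
  have h2 : δ (∑ j, c j * masterDer (θ j) (q j)) = 0 := by
    rw [map_sum]
    exact Finset.sum_eq_zero fun j _ => by rw [hδmul, hp j, hδ (masterDer _ _), hv j]; ring
  rw [h2] at h1
  set Q := ∏ H, linForm (A H) with hQ
  have hQne : eval p Q ≠ 0 := by
    rw [hQ, map_prod, Finset.prod_ne_zero_iff]
    exact fun H _ => by rw [eval_linForm]; exact hne H
  have hQH : ∀ H, Q = linForm (A H) * ∏ H' ∈ Finset.univ.erase H, linForm (A H') := fun H =>
    (Finset.mul_prod_erase _ _ (Finset.mem_univ H)).symm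
  have h3 : masterDer (fun i => Q * C (v i))
      (fun H => C (∑ i, A H i * v i) * ∏ H' ∈ Finset.univ.erase H, linForm (A H')) =
      Q * linForm v - ∑ H, C (∑ i, A H i * v i) *
        ∏ H' ∈ Finset.univ.erase H, linForm (A H') := by
    rw [masterDer, linForm, Finset.mul_sum]
    congr 1
    exact Finset.sum_congr rfl fun i _ => by ring
  have h4 : ∀ H, δ (C (∑ i, A H i * v i) * ∏ H' ∈ Finset.univ.erase H, linForm (A H')) =
      δ Q * ((∑ i, A H i * v i) / ∑ i, A H i * p i) -
        eval p Q * ((∑ i, A H i * v i) / ∑ i, A H i * p i) ^ 2 := fun H => by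
    have h5 := congrArg δ (hQH H)
    have h6 := congrArg (eval p) (hQH H)
    rw [hδmul, hδlin, eval_linForm] at h5
    rw [map_mul, eval_linForm] at h6
    rw [hδmul, hδC, zero_mul, zero_add, eval_C, h5, h6]
    have := hne H
    field_simp
    ring
  rw [h3, map_sub, hδmul, hδlin, eval_linForm, map_sum, Finset.sum_congr rfl fun H _ => h4 H,
    Finset.sum_sub_distrib, ← Finset.mul_sum, ← Finset.mul_sum, ← hcrit v] at h1
  have h7 : ∑ i, v i * v i + ∑ H, ((∑ i, A H i * v i) / ∑ i, A H i * p i) ^ 2 = 0 := by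
    refine mul_left_cancel₀ hQne ?_
    linarith
  refine eq_zero_of_sum_mul_self ?_
  have : 0 ≤ ∑ H, ((∑ i, A H i * v i) / ∑ i, A H i * p i) ^ 2 :=
    Finset.sum_nonneg fun _ _ => sq_nonneg _
  linarith

end Basis

lemma norm_sq_le_sum_sq {n : ℕ} (y : Fin n → ℝ) : ‖y‖ ^ 2 ≤ ∑ i, y i ^ 2 := by
  rw [← Real.le_sqrt (norm_nonneg _) (Finset.sum_nonneg fun i _ => sq_nonneg _),
    pi_norm_le_iff_of_nonneg (Real.sqrt_nonneg _)]
  exact fun i => Real.abs_le_sqrt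
    (Finset.single_le_sum (f := fun i => y i ^ 2) (fun i _ => sq_nonneg _) (Finset.mem_univ i))

lemma sum_mul_le_sum_abs_mul_norm {n : ℕ} (u y : Fin n → ℝ) :
    ∑ i, u i * y i ≤ (∑ i, |u i|) * ‖y‖ := by
  rw [Finset.sum_mul]
  refine Finset.sum_le_sum fun i _ => (le_abs_self _).trans ?_
  rw [abs_mul]
  exact mul_le_mul_of_nonneg_left (norm_le_pi_norm y i) (abs_nonneg _)

lemma exists_isMaxOn_prod_mul_exp {n m : ℕ} (B : Fin m → Fin n → ℝ) {x : Fin n → ℝ}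
    (hx : ∀ H, 0 < ∑ i, B H i * x i) :
    ∃ p ∈ {y : Fin n → ℝ | ∀ H, 0 ≤ ∑ i, B H i * y i},
      IsMaxOn (fun y => (∏ H, ∑ i, B H i * y i) * Real.exp (-∑ i, y i ^ 2 / 2))
        {y : Fin n → ℝ | ∀ H, 0 ≤ ∑ i, B H i * y i} p := by
  have hx0 : 0 < (∏ H, ∑ i, B H i * x i) * Real.exp (-∑ i, x i ^ 2 / 2) :=
    mul_pos (Finset.prod_pos fun H _ => hx H) (Real.exp_pos _)
  refine ContinuousOn.exists_isMaxOn' (x₀ := x) (by fun_prop) ?_ (fun H => (hx H).le) ?_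
  · simp only [Set.ofPred_forall]
    exact isClosed_iInter fun H => isClosed_le continuous_const (by fun_prop)
  set c := ∑ H, ∑ i, |B H i| with hc
  rw [Filter.eventually_inf_principal]
  have hnorm := tendsto_norm_cocompact_atTop (E := Fin n → ℝ)
  filter_upwards [hnorm.eventually_ge_atTop (2 * c + 2), hnorm.eventually_ge_atTop
    (-Real.log ((∏ H, ∑ i, B H i * x i) * Real.exp (-∑ i, x i ^ 2 / 2)))] with y hy1 hy2 hy
  have h1 : ∏ H, ∑ i, B H i * y i ≤ Real.exp (c * ‖y‖) := by
    rw [hc, Finset.sum_mul, Real.exp_sum]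
    refine Finset.prod_le_prod (fun H _ => hy H) fun H _ => ?_
    have := Real.add_one_le_exp ((∑ i, |B H i|) * ‖y‖)
    linarith [sum_mul_le_sum_abs_mul_norm (B H) y]
  have h2 : Real.exp (-∑ i, y i ^ 2 / 2) ≤ Real.exp (-(‖y‖ ^ 2 / 2)) := by
    rw [Real.exp_le_exp, ← Finset.sum_div]
    linarith [norm_sq_le_sum_sq y]
  refine (mul_le_mul h1 h2 (Real.exp_pos _).le (Real.exp_pos _).le).trans ?_
  rw [← Real.exp_add, ← Real.le_log_iff_exp_le hx0]
  nlinarith [norm_nonneg y]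

lemma exists_isCriticalPoint_of_pos {n m : ℕ} (B : Fin m → Fin n → ℝ) {x : Fin n → ℝ}
    (hx : ∀ H, 0 < ∑ i, B H i * x i) :
    ∃ p, (∀ H, 0 < ∑ i, B H i * p i) ∧ IsCriticalPoint B p := by
  obtain ⟨p, hp, hmax⟩ := exists_isMaxOn_prod_mul_exp B hx
  have hpos : ∀ H, 0 < ∑ i, B H i * p i := by
    have h1 : 0 < (∏ H, ∑ i, B H i * p i) * Real.exp (-∑ i, p i ^ 2 / 2) :=
      (mul_pos (Finset.prod_pos fun H _ => hx H) (Real.exp_pos _)).trans_le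
        (hmax fun H => (hx H).le)
    have h2 := Finset.prod_ne_zero_iff.1 (left_ne_zero_of_mul h1.ne')
    exact fun H => (hp H).lt_of_ne (h2 H (Finset.mem_univ H)).symm
  refine ⟨p, hpos, fun v => ?_⟩
  have hlin : ∀ (H) (t : ℝ),
      ∑ i, B H i * (p i + t * v i) = ∑ i, B H i * p i + t * ∑ i, B H i * v i := fun H t => by
    rw [Finset.mul_sum, ← Finset.sum_add_distrib]
    exact Finset.sum_congr rfl fun i _ => by ring
  have hev : ∀ᶠ t in nhds (0 : ℝ), ∀ H, 0 < ∑ i, B H i * (p i + t * v i) := by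
    rw [Filter.eventually_all]
    intro H
    have hcont : Continuous fun t : ℝ => ∑ i, B H i * (p i + t * v i) := by fun_prop
    exact hcont.continuousAt.eventually_const_lt (by simpa using hpos H)
  have hlog : ∀ y : Fin n → ℝ, (∀ H, 0 < ∑ i, B H i * y i) →
      Real.log ((∏ H, ∑ i, B H i * y i) * Real.exp (-∑ i, y i ^ 2 / 2)) =
        ∑ H, Real.log (∑ i, B H i * y i) - ∑ i, y i ^ 2 / 2 := fun y hy => by
    rw [Real.log_mul (Finset.prod_pos fun H _ => hy H).ne' (Real.exp_ne_zero _), Real.log_exp,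
      Real.log_prod fun H _ => (hy H).ne', sub_eq_add_neg]
  have hloc : IsLocalMax (fun t : ℝ => ∑ H, Real.log (∑ i, B H i * (p i + t * v i)) -
      ∑ i, (p i + t * v i) ^ 2 / 2) 0 := by
    filter_upwards [hev] with t ht
    rw [← hlog (fun i => p i + t * v i) ht,
      ← hlog (fun i => p i + 0 * v i) (by simpa using hpos)]
    refine Real.log_le_log (mul_pos (Finset.prod_pos fun H _ => ht H) (Real.exp_pos _)) ?_
    have := hmax (show (fun i => p i + t * v i) ∈ _ from fun H => (ht H).le)
    simpa using this
  have hderiv : HasDerivAt (fun t : ℝ => ∑ H, Real.log (∑ i, B H i * (p i + t * v i)) -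
      ∑ i, (p i + t * v i) ^ 2 / 2)
      (∑ H, (∑ i, B H i * v i) / (∑ i, B H i * p i) - ∑ i, v i * p i) 0 := by
    have hid := hasDerivAt_id (0 : ℝ)
    refine HasDerivAt.sub (HasDerivAt.fun_sum fun H _ => ?_) (HasDerivAt.fun_sum fun i _ => ?_)
    · have h1 : HasDerivAt (fun t : ℝ => ∑ i, B H i * (p i + t * v i)) (∑ i, B H i * v i) 0 := by
        simp only [hlin]
        simpa using (hid.mul_const (∑ i, B H i * v i)).const_add (∑ i, B H i * p i)
      simpa using h1.log (by simpa using (hpos H).ne')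
    · have h1 : HasDerivAt (fun t : ℝ => p i + t * v i) (v i) 0 := by
        simpa using (hid.mul_const (v i)).const_add (p i)
      refine ((h1.fun_pow 2).div_const 2).congr_deriv ?_
      simp
      ring
  have := hloc.hasDerivAt_eq_zero hderiv
  linarith

section Chambers

variable {n m : ℕ} {A : Fin m → Fin n → ℝ}

lemma exists_isCriticalPoint {x : Fin n → ℝ} (hx : ∀ H, ∑ i, A H i * x i ≠ 0) :
    ∃ p, (∀ H, 0 < (∑ i, A H i * x i) * ∑ i, A H i * p i) ∧ IsCriticalPoint A p := by
  have hB : ∀ (H) (y : Fin n → ℝ), ∑ i, (∑ i, A H i * x i) * A H i * y i =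
      (∑ i, A H i * x i) * ∑ i, A H i * y i := fun H y => by
    simp only [mul_assoc, ← Finset.mul_sum]
  obtain ⟨p, hp, hcrit⟩ := exists_isCriticalPoint_of_pos
    (fun H i => (∑ i, A H i * x i) * A H i) (x := x)
    fun H => by rw [hB]; exact mul_self_pos.2 (hx H)
  simp only [hB] at hp
  refine ⟨p, hp, fun v => (hcrit v).trans (Finset.sum_congr rfl fun H _ => ?_)⟩
  rw [hB, hB, mul_div_mul_left _ _ (hx H)]

lemma IsCriticalPoint.eq_of_pos {p p' : Fin n → ℝ} (hp : IsCriticalPoint A p)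
    (hp' : IsCriticalPoint A p')
    (hpos : ∀ H, 0 < (∑ i, A H i * p i) * ∑ i, A H i * p' i) : p = p' := by
  have h1 := hp (p - p')
  have h2 := hp' (p - p')
  refine sub_eq_zero.1 (eq_zero_of_sum_mul_self ?_)
  have h3 : ∑ i, (p - p') i * (p - p') i =
      ∑ i, (p - p') i * p i - ∑ i, (p - p') i * p' i := by
    rw [← Finset.sum_sub_distrib]
    exact Finset.sum_congr rfl fun i _ => by simp only [Pi.sub_apply]; ring
  rw [h3, h1, h2, ← Finset.sum_sub_distrib]
  refine Finset.sum_nonpos fun H _ => ?_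
  have h4 : ∑ i, A H i * (p - p') i = ∑ i, A H i * p i - ∑ i, A H i * p' i := by
    simp [mul_sub]
  have h5 := left_ne_zero_of_mul (hpos H).ne'
  have h6 := right_ne_zero_of_mul (hpos H).ne'
  rw [h4]
  have h8 := hpos H
  generalize ∑ i, A H i * p i = a at *
  generalize ∑ i, A H i * p' i = b at *
  have h7 : (a - b) / a - (a - b) / b = -((a - b) ^ 2 / (a * b)) := by
    field_simp
    ring
  rw [h7, neg_nonpos]
  exact div_nonneg (sq_nonneg _) h8.le

lemma joinedIn_complement {x y : Fin n → ℝ}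
    (hpos : ∀ H, 0 < (∑ i, A H i * x i) * ∑ i, A H i * y i) :
    JoinedIn {x : Fin n → ℝ | ∀ H, ∑ i, A H i * x i ≠ 0} x y := by
  refine JoinedIn.of_segment_subset ?_
  rintro _ ⟨s, t, hs, ht, hst, rfl⟩ H h0
  have h1 : ∑ i, A H i * (s • x + t • y) i =
      s * ∑ i, A H i * x i + t * ∑ i, A H i * y i := by
    simp only [Finset.mul_sum, ← Finset.sum_add_distrib]
    exact Finset.sum_congr rfl fun i _ => by
      simp only [Pi.add_apply, Pi.smul_apply, smul_eq_mul]; ring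
  rw [h1] at h0
  have h2 := hpos H
  generalize ∑ i, A H i * x i = a at *
  generalize ∑ i, A H i * y i = b at *
  have h3 : s * a ^ 2 + t * (a * b) = 0 := by linear_combination a * h0
  have ha : 0 < a ^ 2 := by
    have := left_ne_zero_of_mul h2.ne'
    positivity
  rcases hs.eq_or_lt with rfl | hs
  · have : t = 1 := by linarith
    subst this
    linarith
  · have := mul_pos hs ha
    have := mul_nonneg ht h2.le
    linarith

lemma mul_pos_of_mem_connectedComponent
    {x y : {x : Fin n → ℝ | ∀ H, ∑ i, A H i * x i ≠ 0}} (h : x ∈ connectedComponent y)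
    (H : Fin m) : 0 < (∑ i, A H i * x.1 i) * ∑ i, A H i * y.1 i := by
  have hcont : Continuous fun x : {x : Fin n → ℝ | ∀ H, ∑ i, A H i * x i ≠ 0} =>
      (∑ i, A H i * x.1 i) * ∑ i, A H i * y.1 i :=
    (continuous_finsetSum _ fun i _ => continuous_const.mul
      ((continuous_apply i).comp continuous_subtype_val)).mul continuous_const
  have hclopen : IsClopen {x : {x : Fin n → ℝ | ∀ H, ∑ i, A H i * x i ≠ 0} |
      0 < (∑ i, A H i * x.1 i) * ∑ i, A H i * y.1 i} := by
    refine ⟨?_, isOpen_lt continuous_const hcont⟩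
    convert isClosed_le continuous_const hcont using 1
    ext x
    exact (mul_ne_zero (x.2 H) (y.2 H)).symm.le_iff_lt.symm
  exact hclopen.connectedComponent_subset (mul_self_pos.2 (y.2 H)) h

/-- Every chamber contains exactly one critical point. -/
lemma card_isCriticalPoint_eq_card_connectedComponents :
    Nat.card {p : Fin n → ℝ // (∀ H, ∑ i, A H i * p i ≠ 0) ∧ IsCriticalPoint A p} =
      Nat.card (ConnectedComponents {x : Fin n → ℝ | ∀ H, ∑ i, A H i * x i ≠ 0}) := by
  let F : {p : Fin n → ℝ // (∀ H, ∑ i, A H i * p i ≠ 0) ∧ IsCriticalPoint A p} →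
      ConnectedComponents {x : Fin n → ℝ | ∀ H, ∑ i, A H i * x i ≠ 0} :=
    fun p => ConnectedComponents.mk ⟨p.1, p.2.1⟩
  refine Nat.card_congr (Equiv.ofBijective F ⟨fun p p' h => ?_, fun c => ?_⟩)
  · have h1 := ConnectedComponents.coe_eq_coe'.1 h
    exact Subtype.ext (p.2.2.eq_of_pos p'.2.2 fun H => mul_pos_of_mem_connectedComponent h1 H)
  · obtain ⟨x, rfl⟩ := ConnectedComponents.surjective_coe c
    obtain ⟨p, hpos, hcrit⟩ := exists_isCriticalPoint x.2
    refine ⟨⟨p, fun H => right_ne_zero_of_mul (hpos H).ne', hcrit⟩, ?_⟩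
    exact ConnectedComponents.coe_eq_coe'.2
      (pathComponent_subset_component _ (joinedIn_complement hpos).joined_subtype)

lemma exists_forall_sum_mul_ne_zero (hA : ∀ H, A H ≠ 0) :
    ∃ x : Fin n → ℝ, ∀ H, ∑ i, A H i * x i ≠ 0 := by
  by_contra! h
  have h1 : ∏ H, linForm (A H) = 0 := MvPolynomial.funext fun x => by
    obtain ⟨H, hH⟩ := h x
    rw [map_prod, map_zero]
    exact Finset.prod_eq_zero (Finset.mem_univ H) (by rw [eval_linForm, hH])
  obtain ⟨H, -, hH⟩ := Finset.prod_eq_zero_iff.1 h1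
  exact linForm_ne_zero (hA H) hH

end Chambers

lemma totalDegree_le_of_mul_linForm {n : ℕ} {u : Fin n → ℝ} (hu : u ≠ 0)
    {r g : MvPolynomial (Fin n) ℝ} {d : ℕ} (hg : g.IsHomogeneous d)
    (h : g = r * linForm u) : r.totalDegree ≤ d := by
  rcases eq_or_ne r 0 with rfl | hr
  · simp
  have h1 := totalDegree_mul_of_isDomain hr (linForm_ne_zero hu)
  rw [← h, (isHomogeneous_linForm u).totalDegree (linForm_ne_zero hu)] at h1
  have := hg.totalDegree_le
  lia

/-- if a central arrangement `𝒜` of `m` distinct hyperplanes in `ℝⁿ`,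
given by nonzero pairwise non-proportional linear forms `α H`, is free with exponents
`(d₁,…,dₙ)` (i.e. `D(𝒜)` has a homogeneous basis `θ₁,…,θₙ` with `deg θᵢ = dᵢ`), then
the number of chambers (connected components of the complement) is `∏ᵢ (1 + dᵢ)`. -/
theorem statement8 (n m : ℕ) (α : Fin m → MvPolynomial (Fin n) ℝ)
    (hα1 : ∀ H, (α H).IsHomogeneous 1) (hα0 : ∀ H, α H ≠ 0)
    (hdist : ∀ H H', H ≠ H' → ∀ c : ℝ, α H ≠ c • α H')
    (θ : Fin n → (Fin n → MvPolynomial (Fin n) ℝ)) (d : Fin n → ℕ)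
    (hθD : ∀ i, ∀ H, applyDer n (θ i) (α H) ∈ Ideal.span {α H})
    (hθhom : ∀ i k, (θ i k).IsHomogeneous (d i))
    (hθ0 : ∀ i, θ i ≠ 0)
    (hind : LinearIndependent (MvPolynomial (Fin n) ℝ) θ)
    (hspan : ∀ η : Fin n → MvPolynomial (Fin n) ℝ,
      (∀ H, applyDer n η (α H) ∈ Ideal.span {α H}) →
      ∃ c : Fin n → MvPolynomial (Fin n) ℝ, η = ∑ i : Fin n, c i • θ i) :
    Nat.card (ConnectedComponents {x : Fin n → ℝ | ∀ H, MvPolynomial.eval x (α H) ≠ 0}) =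
      ∏ i : Fin n, (1 + d i) := by
  choose A hA using fun H => exists_eq_linForm (hα1 H)
  obtain rfl : α = fun H => linForm (A H) := funext hA
  have hA0 : ∀ H, A H ≠ 0 := fun H h => hα0 H (by simp [h, linForm])
  have hder : ∀ η H, applyDer n η (linForm (A H)) = ∑ i, η i * C (A H i) := fun η H => by
    simp only [applyDer, pderiv_linForm]
  have hq : ∀ j H, ∃ q, ∑ i, θ j i * C (A H i) = q * linForm (A H) := fun j H => by
    obtain ⟨q, hq⟩ := Ideal.mem_span_singleton'.1 (hθD j H)
    exact ⟨q, by rw [← hder, ← hq]⟩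
  choose q hq using hq
  replace hspan : ∀ η r, IsLogarithmic A η r → ∃ c : Fin n → MvPolynomial (Fin n) ℝ,
      η = ∑ j, c j • θ j := fun η r hη => hspan η fun H =>
    Ideal.mem_span_singleton'.2 ⟨r H, by rw [hder, hη H]⟩
  have hzero := forall_eval_masterDer_eq_zero_iff hA0 hq hspan
  have hdeg : ∀ j H, (q j H).totalDegree ≤ d j := fun j H =>
    totalDegree_le_of_mul_linForm (hA0 H)
      (IsHomogeneous.sum _ _ _ fun i _ => by
        simpa using (hθhom j i).mul (isHomogeneous_C (Fin n) (A H i))) (hq j H)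
  have hcard := card_zeros_eq_prod (fun j => masterDer (θ j) (q j))
    (fun j => ∑ i, X i * θ j i) (fun j => 1 + d j) (fun j => Nat.le_add_right 1 _)
    (fun j => IsHomogeneous.sum _ _ _ fun i _ => (isHomogeneous_X ℝ i).mul (hθhom j i))
    (fun j => by
      rw [masterDer, sub_sub_cancel, add_comm, Nat.lt_succ_iff]
      exact totalDegree_finsetSum_le fun H _ => hdeg j H)
    (eq_zero_of_aeval_leadingForm_eq_zero hA0 hq hspan)
    (exists_ofReal_of_masterDer_eq_zero hA0 hq hspan)
    (eq_zero_of_masterDer_derivative_eq_zero hA0 hq hspan)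
    (by
      obtain ⟨x, hx⟩ := exists_forall_sum_mul_ne_zero hA0
      obtain ⟨p, hpos, hcrit⟩ := exists_isCriticalPoint hx
      exact ⟨p, (hzero p).2 ⟨fun H => right_ne_zero_of_mul (hpos H).ne', hcrit⟩⟩)
  have hset : {x : Fin n → ℝ | ∀ H, eval x (linForm (A H)) ≠ 0} =
      {x | ∀ H, ∑ i, A H i * x i ≠ 0} := by
    simp only [eval_linForm]
  rw [hset, ← hcard, ← card_isCriticalPoint_eq_card_connectedComponents]
  exact (Nat.card_congr (Equiv.subtypeEquivRight hzero)).symm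
end
end
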